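/- Let ℓ ≥ 1, let ε : (0,∞) → (0,∞) satisfy ε_t → 0 and ε_t ≥ d/log t for some d > 0 and all sufficiently large t, and let f^(1),…,f^(ℓ) : (0,∞) → ℝ satisfy 0 ≤ f_t^(1) < … < f_t^(ℓ) < C for some constant C, with log|f_t^(j) − f_t^(i)| / log ε_t → c_{i,j} ∈ [0,∞] for all i ≠ j. Let μ₁,…,μ_ℓ ∈ ℂ and let ω be uniformly distributed on (0,1). Then (−log ε_t)^{−1/2} · Σ_{j=1}^ℓ μ_j · Σ_{p ≤ t} p^{−i ω t} / p^{1/2 + ε_t + i f_t^(j)} (inner sum over primes p ≤ t) converges in distribution, as t → ∞, to a centered complex normal random variable with variance σ² = Σ_{j=1}^ℓ |μ_j|² + Σ_{j ≠ k} conj(μ_j)·μ_k·min(1, c_{j,k}). -/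

import Mathlib

open MeasureTheory Filter
open scoped ENNReal Topology ComplexConjugate

/-- The law of a standard complex normal variable. -/
noncomputable def stdComplexNormal : Measure ℂ :=
  ((ProbabilityTheory.gaussianReal 0 (1/2)).prod (ProbabilityTheory.gaussianReal 0 (1/2))).map
    (fun p => (p.1 : ℂ) + p.2 * Complex.I)

/-- The law of a centered complex normal variable with variance `v`. -/
noncomputable def complexNormal (v : ℝ) : Measure ℂ :=
  stdComplexNormal.map (fun z => (Real.sqrt v : ℂ) * z)

/-- The indicator function of the primes, as a complex arithmetic function. -/
noncomputable def primeIndicator (n : ℕ) : ℂ := if n.Prime then 1 else 0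

lemma norm_primeIndicator_le (n : ℕ) : ‖primeIndicator n‖ ≤ 1 := by
  unfold primeIndicator
  split_ifs <;> simp

lemma abscissaOfAbsConv_primeIndicator_le : LSeries.abscissaOfAbsConv primeIndicator ≤ 1 :=
  LSeries.abscissaOfAbsConv_le_of_le_const ⟨1, fun n _ => norm_primeIndicator_le n⟩

lemma abscissaOfAbsConv_primeIndicator_lt {s : ℂ} (hs : 1 < s.re) :
    LSeries.abscissaOfAbsConv primeIndicator < s.re :=
  abscissaOfAbsConv_primeIndicator_le.trans_lt (by exact_mod_cast hs)

/-- The prime zeta function has a logarithmic singularity at `1` and is otherwise bounded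
near compact pieces of the line `re s = 1`. -/
theorem exists_norm_LSeries_primeIndicator_add_log_le (C : ℝ) :
    ∃ B : ℝ, ∀ s : ℂ, 0 < s.re → s.re ≤ 1 → |s.im| ≤ C →
      ‖LSeries primeIndicator (1 + s) + Complex.log s‖ ≤ B := by
  set a : ZMod 1 := 0
  have ha : IsUnit a := isUnit_of_subsingleton _
  set h : ℕ → ℝ := fun n =>
    if n.Prime then 0 else ArithmeticFunction.vonMangoldt.residueClass a n with hh
  have hh0 : ∀ n, 0 ≤ h n := by
    intro n
    simp only [hh]
    split_ifs
    · exact le_rfl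
    · exact ArithmeticFunction.vonMangoldt.residueClass_nonneg a n
  have hsum : Summable fun n : ℕ => h n / n :=
    ArithmeticFunction.vonMangoldt.summable_residueClass_non_primes_div a
  have hres : ∀ n, ((ArithmeticFunction.vonMangoldt.residueClass a n : ℝ) : ℂ)
      = LSeries.logMul primeIndicator n + (h n : ℂ) := by
    intro n
    simp only [hh, LSeries.logMul, primeIndicator]
    split_ifs with hp
    · have : ArithmeticFunction.vonMangoldt.residueClass a n = Real.log n := by
        rw [ArithmeticFunction.vonMangoldt.residueClass,
          Set.indicator_of_mem (by simp; exact Subsingleton.elim _ _),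
          ArithmeticFunction.vonMangoldt_apply_prime hp]
      rw [this]
      simp
    · simp
  have hterm : ∀ s : ℂ, 1 < s.re → ∀ n, ‖LSeries.term (fun n => (h n : ℂ)) s n‖ ≤ h n / n := by
    intro s hs n
    rw [LSeries.norm_term_eq]
    split_ifs with hn
    · simp [hn]
    · rw [Complex.norm_real, Real.norm_of_nonneg (hh0 n)]
      have h1 : (1 : ℝ) ≤ n := by exact_mod_cast Nat.one_le_iff_ne_zero.mpr hn
      have : (n : ℝ) ≤ (n : ℝ) ^ s.re := by
        calc (n : ℝ) = (n : ℝ) ^ (1 : ℝ) := by simp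
          _ ≤ _ := Real.rpow_le_rpow_of_exponent_le h1 hs.le
      exact div_le_div_of_nonneg_left (hh0 n) (by linarith) this
  have hsummable : ∀ s : ℂ, 1 < s.re → LSeriesSummable (fun n => (h n : ℂ)) s := by
    intro s hs
    exact Summable.of_norm_bounded hsum (hterm s hs)
  have hLh : ∀ s : ℂ, 1 < s.re → ‖LSeries (fun n => (h n : ℂ)) s‖ ≤ ∑' n, h n / n := by
    intro s hs
    refine tsum_of_norm_bounded hsum.hasSum (hterm s hs)
  set K : Set ℂ := {s | 1 ≤ s.re} ∩ {s | s.re ≤ 2} ∩ {s | |s.im| ≤ C} with hK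
  have hKc : IsCompact K := by
    rw [Metric.isCompact_iff_isClosed_bounded]
    constructor
    · refine ((isClosed_le continuous_const Complex.continuous_re).inter
        (isClosed_le Complex.continuous_re continuous_const)).inter
        (isClosed_le (Complex.continuous_im.abs) continuous_const)
    · refine (Metric.isBounded_closedBall (x := (0 : ℂ)) (r := 2 + C)).subset ?_
      rintro s ⟨⟨h1, h2⟩, h3⟩
      simp only [Set.mem_ofPred_eq] at h1 h2 h3
      rw [mem_closedBall_zero_iff]
      refine (Complex.norm_le_abs_re_add_abs_im s).trans ?_
      rw [abs_of_nonneg (by linarith)]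
      linarith
  obtain ⟨B₁, hB₁⟩ := hKc.exists_bound_of_continuousOn
    ((ArithmeticFunction.vonMangoldt.continuousOn_LFunctionResidueClassAux a).mono
      (fun s hs => hs.1.1))
  set U : Set ℂ := {s | 1 < s.re} ∩ {s | s.re ≤ 2} ∩ {s | |s.im| ≤ C} with hU
  have hUK : U ⊆ K := fun s hs => ⟨⟨(show (1 : ℝ) < s.re from hs.1.1).le, hs.1.2⟩, hs.2⟩
  have hUconv : Convex ℝ U := by
    refine ((convex_halfSpace_re_gt 1).inter (convex_halfSpace_re_le 2)).inter ?_
    have : {s : ℂ | |s.im| ≤ C} = {s : ℂ | s.im ≤ C} ∩ {s : ℂ | -C ≤ s.im} := by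
      ext s
      simp [abs_le, and_comm]
    rw [this]
    exact (convex_halfSpace_im_le C).inter (convex_halfSpace_im_ge (-C))
  set D : ℝ := B₁ + ∑' n, h n / n with hD
  set G : ℂ → ℂ := fun s => LSeries primeIndicator s + Complex.log (s - 1) with hG
  have hderiv : ∀ s ∈ U, HasDerivWithinAt G
      (-LSeries (LSeries.logMul primeIndicator) s + (s - 1)⁻¹) U s := by
    intro s hs
    have hs1 : 1 < s.re := hs.1.1
    refine ((LSeries_hasDerivAt (abscissaOfAbsConv_primeIndicator_lt hs1)).add
      ?_).hasDerivWithinAt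
    have := ((hasDerivAt_id s).sub_const (1 : ℂ)).clog
      (Or.inl (by simpa using hs1) : (id s - 1) ∈ Complex.slitPlane)
    simpa using this
  have hbound : ∀ s ∈ U, ‖-LSeries (LSeries.logMul primeIndicator) s + (s - 1)⁻¹‖ ≤ D := by
    intro s hs
    have hs1 : 1 < s.re := hs.1.1
    have e1 := ArithmeticFunction.vonMangoldt.eqOn_LFunctionResidueClassAux ha
      (x := s) hs1
    have e2 : LSeries (fun n => ((ArithmeticFunction.vonMangoldt.residueClass a n : ℝ) : ℂ)) s
        = LSeries (LSeries.logMul primeIndicator) s + LSeries (fun n => (h n : ℂ)) s := by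
      rw [← LSeries_add (LSeriesSummable_logMul_of_lt_re
        (abscissaOfAbsConv_primeIndicator_lt hs1)) (hsummable s hs1)]
      exact LSeries_congr (fun {n} _ => hres n) s
    have e3 : -LSeries (LSeries.logMul primeIndicator) s + (s - 1)⁻¹
        = -ArithmeticFunction.vonMangoldt.LFunctionResidueClassAux a s
          + LSeries (fun n => (h n : ℂ)) s := by
      rw [e1]
      simp only [Nat.totient_one, Nat.cast_one, inv_one, one_div]
      rw [e2]
      ring
    rw [e3]
    refine (norm_add_le _ _).trans ?_
    rw [norm_neg]
    exact add_le_add (hB₁ s (hUK hs)) (hLh s hs1)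
  refine ⟨‖G 2‖ + D * (1 + |C|), ?_⟩
  intro s h1 h2 h3
  have hC : 0 ≤ C := (abs_nonneg _).trans h3
  have hmem : 1 + s ∈ U := by
    refine ⟨⟨?_, ?_⟩, ?_⟩ <;> simp <;> linarith
  have h2mem : (2 : ℂ) ∈ U := by
    refine ⟨⟨?_, ?_⟩, ?_⟩ <;> simp
    exact hC
  have key := Convex.norm_image_sub_le_of_norm_hasDerivWithin_le hderiv hbound hUconv h2mem hmem
  have hD0 : 0 ≤ D := (norm_nonneg _).trans (hbound _ h2mem)
  have h4 : ‖1 + s - 2‖ ≤ 1 + |C| := by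
    refine (Complex.norm_le_abs_re_add_abs_im _).trans ?_
    have : |(1 + s - 2).re| ≤ 1 := by
      rw [abs_le]
      constructor <;> simp <;> linarith
    have : |(1 + s - 2).im| ≤ |C| := by
      simp
      exact h3.trans (le_abs_self C)
    linarith
  have h5 : G (1 + s) = LSeries primeIndicator (1 + s) + Complex.log s := by
    simp [hG]
  rw [← h5]
  calc ‖G (1 + s)‖ = ‖G 2 + (G (1 + s) - G 2)‖ := by ring_nf
    _ ≤ ‖G 2‖ + ‖G (1 + s) - G 2‖ := norm_add_le _ _
    _ ≤ _ := by
      gcongr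
      exact key.trans (by gcongr)

lemma summable_prime_rpow {x : ℝ} (hx : 0 < x) :
    Summable fun n : ℕ => if n.Prime then (n : ℝ) ^ (-(1 + x)) else 0 := by
  refine Summable.of_nonneg_of_le (fun n => ?_) (fun n => ?_)
    (Real.summable_nat_rpow.mpr (show -(1 + x) < -1 by linarith))
  · split_ifs <;> positivity
  · split_ifs
    · exact le_rfl
    · positivity

lemma LSeries_primeIndicator_ofReal (x : ℝ) :
    LSeries primeIndicator (1 + x) =
      ((∑' n : ℕ, if n.Prime then (n : ℝ) ^ (-(1 + x)) else 0 : ℝ) : ℂ) := by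
  rw [LSeries, Complex.ofReal_tsum]
  refine tsum_congr fun n => ?_
  rw [LSeries.term_def]
  by_cases hn : n.Prime
  · rw [if_neg hn.ne_zero, if_pos hn, primeIndicator, if_pos hn, one_div, ← Complex.cpow_neg,
      Complex.ofReal_cpow (by positivity)]
    simp
  · simp [primeIndicator, hn]

/-- Tails of the prime zeta series on the real axis: the primes `p` with `log p ≥ 1 / y`
contribute a logarithm of the ratio between `max x y` and `x`. -/
theorem exists_sum_prime_rpow_tail_le :
    ∃ B : ℝ, ∀ x y : ℝ, 0 < x → 0 < y → max x y ≤ 1 / 2 → ∀ T : Finset ℕ,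
      (∀ p ∈ T, p.Prime ∧ 1 / y ≤ Real.log p) →
      ∑ p ∈ T, (p : ℝ) ^ (-(1 + x)) ≤ B + 2 * Real.log (2 * max x y / x) := by
  obtain ⟨B, hB⟩ := exists_norm_LSeries_primeIndicator_add_log_le 0
  refine ⟨4 * B, ?_⟩
  intro x y hx hy hxy T hT
  set R : ℝ → ℝ := fun x => ∑' n : ℕ, if n.Prime then (n : ℝ) ^ (-(1 + x)) else 0 with hR
  have hRB : ∀ z : ℝ, 0 < z → z ≤ 1 → |R z + Real.log z| ≤ B := by
    intro z hz hz1
    have := hB z (by simpa using hz) (by simpa using hz1) (by simp)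
    rw [LSeries_primeIndicator_ofReal, ← Complex.ofReal_log hz.le, ← Complex.ofReal_add,
      Complex.norm_real] at this
    exact this
  set w : ℝ := max x y with hw
  have hwx : x ≤ w := le_max_left _ _
  have hwy : y ≤ w := le_max_right _ _
  have hw0 : 0 < w := hx.trans_le hwx
  set u : ℕ → ℝ := fun n => if n.Prime then (n : ℝ) ^ (-(1 + x)) else 0 with hu
  set v : ℕ → ℝ := fun n => if n.Prime then (n : ℝ) ^ (-(1 + 2 * w)) else 0 with hv
  have hus : Summable u := summable_prime_rpow hx
  have hvs : Summable v := summable_prime_rpow (by linarith)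
  have huv : ∀ n, 0 ≤ u n - v n := by
    intro n
    simp only [hu, hv]
    split_ifs with hp
    · rw [sub_nonneg]
      exact Real.rpow_le_rpow_of_exponent_le (by exact_mod_cast hp.one_le) (by linarith)
    · simp
  have h1 : ∑ p ∈ T, (u p - v p) ≤ R x - R (2 * w) := by
    rw [hR]
    simp only
    rw [← hus.tsum_sub hvs]
    exact (hus.sub hvs).sum_le_tsum T (fun n _ => huv n)
  have he : Real.exp (-1) ≤ 1 / 2 := by
    rw [Real.exp_neg]
    have := Real.add_one_le_exp 1
    rw [inv_le_comm₀ (Real.exp_pos _) (by norm_num)]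
    linarith
  have h2 : ∀ p ∈ T, (p : ℝ) ^ (-(1 + x)) ≤ 2 * (u p - v p) := by
    intro p hp
    obtain ⟨hpp, hpl⟩ := hT p hp
    have hp0 : (0 : ℝ) < p := by exact_mod_cast hpp.pos
    simp only [hu, hv, if_pos hpp]
    have h3 : (p : ℝ) ^ (-(1 + 2 * w)) = (p : ℝ) ^ (-(1 + x)) * (p : ℝ) ^ (-(2 * w - x)) := by
      rw [← Real.rpow_add hp0]
      congr 1
      ring
    have h4 : (p : ℝ) ^ (-(2 * w - x)) ≤ 1 / 2 := by
      refine le_trans ?_ he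
      rw [Real.rpow_def_of_pos hp0, Real.exp_le_exp]
      have h5 : y * (1 / y) ≤ (2 * w - x) * Real.log p :=
        mul_le_mul (by linarith) hpl (by positivity) (by linarith)
      rw [mul_one_div_cancel hy.ne'] at h5
      linarith
    rw [h3]
    have h6 : 0 ≤ (p : ℝ) ^ (-(1 + x)) := by positivity
    nlinarith
  have h7 := hRB x hx (by linarith)
  have h8 := hRB (2 * w) (by linarith) (by linarith)
  rw [abs_le] at h7 h8
  rw [Real.log_div (by linarith) hx.ne']
  calc ∑ p ∈ T, (p : ℝ) ^ (-(1 + x)) ≤ ∑ p ∈ T, 2 * (u p - v p) := Finset.sum_le_sum h2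
    _ = 2 * ∑ p ∈ T, (u p - v p) := by rw [Finset.mul_sum]
    _ ≤ _ := by linarith

/-- Truncating the prime zeta function at `exp (1 / y)` changes it by at most a logarithm of the
ratio between `max x y` and `x`. -/
theorem exists_norm_LSeries_primeIndicator_sub_sum_le :
    ∃ B : ℝ, ∀ x y τ : ℝ, 0 < x → 0 < y → max x y ≤ 1 / 2 → ∀ S : Finset ℕ,
      (∀ p ∈ S, p.Prime) → (∀ p : ℕ, p.Prime → p ∉ S → 1 / y ≤ Real.log p) →
      ‖LSeries primeIndicator (1 + (x + τ * Complex.I)) -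
          ∑ p ∈ S, (p : ℂ) ^ (-(1 + (x + τ * Complex.I)))‖
        ≤ B + 2 * Real.log (2 * max x y / x) := by
  obtain ⟨B, hB⟩ := exists_sum_prime_rpow_tail_le
  refine ⟨B, ?_⟩
  intro x y τ hx hy hxy S hS hS'
  set s : ℂ := 1 + (x + τ * Complex.I) with hs
  have hsre : s.re = 1 + x := by simp [hs]
  have hsum : LSeriesSummable primeIndicator s :=
    LSeriesSummable_of_abscissaOfAbsConv_lt_re
      (abscissaOfAbsConv_primeIndicator_lt (by rw [hsre]; linarith))
  have hterm : ∀ n : ℕ, LSeries.term primeIndicator s n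
      = if n.Prime then (n : ℂ) ^ (-s) else 0 := by
    intro n
    rw [LSeries.term_def]
    by_cases hn : n.Prime
    · rw [if_neg hn.ne_zero, if_pos hn, primeIndicator, if_pos hn, one_div, Complex.cpow_neg]
    · simp [primeIndicator, hn]
  have hlim : Tendsto (fun T : Finset ℕ => ‖∑ n ∈ T, LSeries.term primeIndicator s n -
      ∑ p ∈ S, (p : ℂ) ^ (-s)‖) atTop
      (𝓝 ‖LSeries primeIndicator s - ∑ p ∈ S, (p : ℂ) ^ (-s)‖) :=
    (hsum.hasSum.sub_const _).norm
  refine le_of_tendsto hlim ?_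
  filter_upwards [eventually_ge_atTop S] with T hT
  have h1 : ∑ p ∈ S, (p : ℂ) ^ (-s) = ∑ n ∈ S, LSeries.term primeIndicator s n :=
    Finset.sum_congr rfl fun p hp => by rw [hterm, if_pos (hS p hp)]
  rw [h1, ← Finset.sum_sdiff_eq_sub hT]
  have h2 : ∑ n ∈ T \ S, LSeries.term primeIndicator s n
      = ∑ n ∈ (T \ S).filter Nat.Prime, (n : ℂ) ^ (-s) := by
    rw [Finset.sum_filter]
    exact Finset.sum_congr rfl fun n _ => hterm n
  rw [h2]
  refine (norm_sum_le _ _).trans (le_trans (le_of_eq ?_) (hB x y hx hy hxy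
    ((T \ S).filter Nat.Prime) ?_))
  · refine Finset.sum_congr rfl fun n hn => ?_
    have hp := (Finset.mem_filter.mp hn).2
    rw [Complex.norm_natCast_cpow_of_pos hp.pos]
    simp [hsre]
  · intro p hp
    obtain ⟨hp1, hp2⟩ := Finset.mem_filter.mp hp
    exact ⟨hp2, hS' p hp2 (Finset.mem_sdiff.mp hp1).2⟩

/-- Oscillatory integral over the unit interval. -/
lemma norm_integral_Ioo_exp_le {a : ℝ} (ha : a ≠ 0) :
    ‖∫ ω in Set.Ioo (0 : ℝ) 1, Complex.exp ((a * ω : ℝ) * Complex.I)‖ ≤ 2 / |a| := by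
  rw [← integral_Ioc_eq_integral_Ioo, ← intervalIntegral.integral_of_le zero_le_one]
  have hc : (a : ℂ) * Complex.I ≠ 0 := by simp [ha]
  have h := integral_exp_mul_complex (a := 0) (b := 1) hc
  have h2 : ∀ ω : ℝ, Complex.exp ((a * ω : ℝ) * Complex.I) = Complex.exp (a * Complex.I * ω) := by
    intro ω
    congr 1
    push_cast
    ring
  simp_rw [h2]
  rw [h, norm_div]
  have h3 : ‖(a : ℂ) * Complex.I‖ = |a| := by simp
  rw [h3]
  gcongr
  refine (norm_sub_le _ _).trans ?_
  simp [Complex.norm_exp]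
  norm_num

lemma sqrt_mul_inv_log_sub_le {p q : ℕ} (hp : 0 < p) (hpq : p < q) :
    ((√p)⁻¹ * (√q)⁻¹) / (Real.log q - Real.log p) ≤
      3 / 2 * ((q - p : ℕ) : ℝ)⁻¹ + 1 / 2 * (p : ℝ)⁻¹ := by
  obtain ⟨h, rfl⟩ : ∃ h, q = p + h := ⟨q - p, by omega⟩
  have hh : 0 < h := by omega
  rw [Nat.add_sub_cancel_left]
  push_cast
  have hp' : (0 : ℝ) < p := by exact_mod_cast hp
  have hh' : (0 : ℝ) < h := by exact_mod_cast hh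
  have hlog : (h : ℝ) / (p + h) ≤ Real.log (p + h) - Real.log p := by
    have := Real.log_le_sub_one_of_pos (show (0 : ℝ) < p / (p + h) by positivity)
    rw [Real.log_div (by positivity) (by positivity)] at this
    have e : (h : ℝ) / (p + h) = 1 - p / (p + h) := by field_simp; ring
    rw [e]
    linarith
  set x := √(p : ℝ) with hx
  set y := √(h : ℝ) with hy
  set z := √((p : ℝ) + h) with hz
  have hx0 : 0 < x := Real.sqrt_pos.mpr hp'
  have hy0 : 0 < y := Real.sqrt_pos.mpr hh'
  have hz0 : 0 < z := Real.sqrt_pos.mpr (by positivity)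
  have hx2 : (p : ℝ) = x ^ 2 := (Real.sq_sqrt hp'.le).symm
  have hy2 : (h : ℝ) = y ^ 2 := (Real.sq_sqrt hh'.le).symm
  have hz2 : (p : ℝ) + h = z ^ 2 := (Real.sq_sqrt (by positivity)).symm
  have hzle : z ≤ x + y := by
    rw [hz]
    apply Real.sqrt_le_iff.mpr
    refine ⟨by positivity, ?_⟩
    rw [hx2, hy2]
    nlinarith
  have hpos : (0 : ℝ) < h / (p + h) := by positivity
  calc (x⁻¹ * z⁻¹) / (Real.log (p + h) - Real.log p) ≤ (x⁻¹ * z⁻¹) / (h / (p + h)) := by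
        gcongr
    _ = z / (x * y ^ 2) := by
        rw [hz2, hy2]
        field_simp
    _ ≤ (x + y) / (x * y ^ 2) := by gcongr
    _ = (y ^ 2)⁻¹ + x⁻¹ * y⁻¹ := by field_simp
    _ ≤ 3 / 2 * (h : ℝ)⁻¹ + 1 / 2 * (p : ℝ)⁻¹ := by
        rw [hx2, hy2, ← inv_pow, ← inv_pow]
        nlinarith [sq_nonneg (x⁻¹ - y⁻¹)]

lemma sum_Ico_inv_le {q : ℕ} {t : ℝ} (hq : 1 ≤ q) (hqt : (q : ℝ) ≤ t) :
    ∑ p ∈ Finset.Ico 1 q, (p : ℝ)⁻¹ ≤ 1 + Real.log t := by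
  have h1 : ∑ p ∈ Finset.Ico 1 q, (p : ℝ)⁻¹ ≤ (harmonic q : ℝ) := by
    rw [harmonic_eq_sum_Icc]
    push_cast
    refine Finset.sum_le_sum_of_subset_of_nonneg (fun n hn => ?_) (fun _ _ _ => by positivity)
    simp only [Finset.mem_Ico, Finset.mem_Icc] at *
    omega
  refine h1.trans ((harmonic_le_one_add_log q).trans ?_)
  have : (0 : ℝ) < q := by exact_mod_cast hq
  have := Real.log_le_log this hqt
  linarith

lemma sum_sqrt_mul_inv_log_sub_le {q : ℕ} {t : ℝ} (hq : 1 ≤ q) (hqt : (q : ℝ) ≤ t) :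
    ∑ p ∈ Finset.Ico 1 q, ((√p)⁻¹ * (√q)⁻¹) / (Real.log q - Real.log p) ≤
      2 * (1 + Real.log t) := by
  have h1 : ∑ p ∈ Finset.Ico 1 q, ((√p)⁻¹ * (√q)⁻¹) / (Real.log q - Real.log p) ≤
      ∑ p ∈ Finset.Ico 1 q, (3 / 2 * ((q - p : ℕ) : ℝ)⁻¹ + 1 / 2 * (p : ℝ)⁻¹) := by
    refine Finset.sum_le_sum fun p hp => ?_
    rw [Finset.mem_Ico] at hp
    exact sqrt_mul_inv_log_sub_le (by omega) hp.2
  have h2 : ∑ p ∈ Finset.Ico 1 q, ((q - p : ℕ) : ℝ)⁻¹ = ∑ p ∈ Finset.Ico 1 q, (p : ℝ)⁻¹ := by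
    refine Finset.sum_nbij' (fun p => q - p) (fun p => q - p) ?_ ?_ ?_ ?_ ?_ <;>
      intro p hp <;> simp only [Finset.mem_Ico] at * <;> omega
  rw [Finset.sum_add_distrib, ← Finset.mul_sum, ← Finset.mul_sum, h2] at h1
  have := sum_Ico_inv_le hq hqt
  linarith

/-- The off-diagonal contribution to the mean square of a Dirichlet polynomial over primes. -/
lemma eventually_sum_primes_offDiag_le :
    ∀ᶠ t : ℝ in atTop, ∀ S : Finset ℕ, (∀ p ∈ S, p.Prime ∧ (p : ℝ) ≤ t) →
      ∑ p ∈ S, ∑ q ∈ S, (if p = q then 0 else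
        ((√p)⁻¹ * (√q)⁻¹) / |Real.log q - Real.log p|) ≤ 24 * t := by
  filter_upwards [Chebyshev.eventually_primeCounting_le one_pos,
    eventually_ge_atTop (Real.exp 1)] with t ht hte S hS
  have ht0 : 0 < t := (Real.exp_pos 1).trans_le hte
  have hlogt : 1 ≤ Real.log t := (Real.le_log_iff_exp_le ht0).mpr hte
  set W : ℕ → ℕ → ℝ := fun q p => if p < q then
    ((√p)⁻¹ * (√q)⁻¹) / (Real.log q - Real.log p) else 0 with hW
  have hsplit : ∀ p ∈ S, ∀ q ∈ S, (if p = q then 0 else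
        ((√(p : ℝ))⁻¹ * (√(q : ℝ))⁻¹) / |Real.log q - Real.log p|) = W q p + W p q := by
    intro p hp q hq
    have hp0 : (0 : ℝ) < p := by exact_mod_cast (hS p hp).1.pos
    have hq0 : (0 : ℝ) < q := by exact_mod_cast (hS q hq).1.pos
    rcases lt_trichotomy p q with h | h | h
    · have : Real.log p < Real.log q := Real.log_lt_log hp0 (by exact_mod_cast h)
      simp only [hW, if_pos h, if_neg h.ne, if_neg h.asymm, add_zero]
      rw [abs_of_pos (by linarith)]
    · simp [hW, h]
    · have : Real.log q < Real.log p := Real.log_lt_log hq0 (by exact_mod_cast h)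
      simp only [hW, if_pos h, if_neg h.ne', if_neg h.asymm, zero_add]
      rw [abs_sub_comm, abs_of_pos (by linarith), mul_comm (√(q : ℝ))⁻¹]
  have hcard : (S.card : ℝ) ≤ 3 * t / Real.log t := by
    have h1 : S.card ≤ Nat.primeCounting ⌊t⌋₊ := by
      rw [Nat.primeCounting, Nat.primeCounting', Nat.count_eq_card_filter_range]
      refine Finset.card_le_card fun p hp => ?_
      rw [Finset.mem_filter, Finset.mem_range]
      exact ⟨Nat.lt_succ_of_le (Nat.le_floor (hS p hp).2), (hS p hp).1⟩
    have h2 : Real.log 4 ≤ 2 := by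
      rw [show (4 : ℝ) = 2 ^ 2 by norm_num, Real.log_pow]
      have := Real.log_two_lt_d9
      push_cast
      linarith
    calc (S.card : ℝ) ≤ Nat.primeCounting ⌊t⌋₊ := by exact_mod_cast h1
      _ ≤ (Real.log 4 + 1) * t / Real.log t := ht
      _ ≤ _ := by
        gcongr
        linarith
  have hrow : ∀ q ∈ S, ∑ p ∈ S, W q p ≤ 4 * Real.log t := by
    intro q hq
    have h1 : ∑ p ∈ S, W q p ≤
        ∑ p ∈ Finset.Ico 1 q, ((√p)⁻¹ * (√q)⁻¹) / (Real.log q - Real.log p) := by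
      rw [hW]
      simp only
      rw [← Finset.sum_filter]
      refine Finset.sum_le_sum_of_subset_of_nonneg (fun p hp => ?_) (fun p hp _ => ?_)
      · rw [Finset.mem_filter] at hp
        rw [Finset.mem_Ico]
        exact ⟨(hS p hp.1).1.one_le, hp.2⟩
      · rw [Finset.mem_Ico] at hp
        have : Real.log p ≤ Real.log q :=
          Real.log_le_log (by exact_mod_cast hp.1) (by exact_mod_cast hp.2.le)
        exact div_nonneg (by positivity) (by linarith)
    have := sum_sqrt_mul_inv_log_sub_le (hS q hq).1.one_le (hS q hq).2
    linarith
  have htot : ∑ q ∈ S, ∑ p ∈ S, W q p ≤ 12 * t := by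
    calc ∑ q ∈ S, ∑ p ∈ S, W q p ≤ ∑ q ∈ S, 4 * Real.log t := Finset.sum_le_sum hrow
      _ = S.card * (4 * Real.log t) := by simp
      _ ≤ 3 * t / Real.log t * (4 * Real.log t) := by gcongr
      _ = 12 * t := by field_simp; ring
  rw [Finset.sum_congr rfl fun p hp => Finset.sum_congr rfl fun q hq => hsplit p hp q hq]
  simp_rw [Finset.sum_add_distrib]
  rw [Finset.sum_comm (f := fun p q => W q p)]
  linarith

/-- A mean value theorem for Dirichlet polynomials supported on primes. -/
theorem eventually_integral_norm_sq_sum_primes_le :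
    ∀ᶠ t : ℝ in atTop, ∀ (S : Finset ℕ) (a : ℕ → ℂ) (M : ℝ),
      (∀ p ∈ S, p.Prime ∧ (p : ℝ) ≤ t) → (∀ p ∈ S, ‖a p‖ ≤ M * (√p)⁻¹) →
      ∫ ω in Set.Ioo (0 : ℝ) 1,
          ‖∑ p ∈ S, a p * Complex.exp ((-(t * Real.log p) * ω : ℝ) * Complex.I)‖ ^ 2
        ≤ ∑ p ∈ S, ‖a p‖ ^ 2 + 48 * M ^ 2 := by
  filter_upwards [eventually_sum_primes_offDiag_le, eventually_gt_atTop 0]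
    with t ht ht0 S a M hS ha
  set e : ℕ → ℕ → ℝ → ℂ := fun p q ω =>
    Complex.exp ((t * (Real.log q - Real.log p) * ω : ℝ) * Complex.I) with he
  have hexp : ∀ ω : ℝ,
      ((‖∑ p ∈ S, a p * Complex.exp ((-(t * Real.log p) * ω : ℝ) * Complex.I)‖ ^ 2 : ℝ) : ℂ)
        = ∑ p ∈ S, ∑ q ∈ S, a p * conj (a q) * e p q ω := by
    intro ω
    rw [Complex.ofReal_pow, ← Complex.mul_conj', map_sum, Finset.sum_mul_sum]
    refine Finset.sum_congr rfl fun p _ => Finset.sum_congr rfl fun q _ => ?_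
    rw [map_mul, ← Complex.exp_conj, map_mul, Complex.conj_I, Complex.conj_ofReal,
      mul_mul_mul_comm, ← Complex.exp_add, he]
    congr 2
    push_cast
    ring
  have hexpint : ∀ p q, Integrable (fun ω => a p * conj (a q) * e p q ω)
      (volume.restrict (Set.Ioo (0 : ℝ) 1)) := by
    intro p q
    refine Integrable.const_mul ?_ _
    refine (Continuous.integrableOn_Icc (a := 0) (b := 1) ?_).mono_set Set.Ioo_subset_Icc_self
    rw [he]
    fun_prop
  have hI : ((∫ ω in Set.Ioo (0 : ℝ) 1,
          ‖∑ p ∈ S, a p * Complex.exp ((-(t * Real.log p) * ω : ℝ) * Complex.I)‖ ^ 2 : ℝ) : ℂ)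
      = ∑ p ∈ S, ∑ q ∈ S, a p * conj (a q) * ∫ ω in Set.Ioo (0 : ℝ) 1, e p q ω := by
    rw [← integral_complex_ofReal]
    simp_rw [hexp]
    rw [integral_finsetSum _ fun p _ => integrable_finsetSum _ fun q _ => hexpint p q]
    refine Finset.sum_congr rfl fun p _ => ?_
    rw [integral_finsetSum _ fun q _ => hexpint p q]
    refine Finset.sum_congr rfl fun q _ => ?_
    rw [integral_const_mul]
  have hM : ∀ p ∈ S, ∀ q ∈ S, ‖a p‖ * ‖a q‖ ≤ M ^ 2 * ((√p)⁻¹ * (√q)⁻¹) := by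
    intro p hp q hq
    calc ‖a p‖ * ‖a q‖ ≤ (M * (√p)⁻¹) * (M * (√q)⁻¹) :=
          mul_le_mul (ha p hp) (ha q hq) (norm_nonneg _) ((norm_nonneg _).trans (ha p hp))
      _ = _ := by ring
  have hterm : ∀ p ∈ S, ∀ q ∈ S, ‖a p * conj (a q) * ∫ ω in Set.Ioo (0 : ℝ) 1, e p q ω‖ ≤
      (if p = q then ‖a p‖ ^ 2 else 0) + 2 / t * M ^ 2 * (if p = q then 0 else
        ((√p)⁻¹ * (√q)⁻¹) / |Real.log q - Real.log p|) := by
    intro p hp q hq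
    rw [norm_mul, norm_mul, RCLike.norm_conj]
    split_ifs with hpq
    · subst hpq
      simp [he, sq]
    · have hp0 : (0 : ℝ) < p := by exact_mod_cast (hS p hp).1.pos
      have hq0 : (0 : ℝ) < q := by exact_mod_cast (hS q hq).1.pos
      have hlog : Real.log q - Real.log p ≠ 0 := by
        rw [sub_ne_zero]
        intro h
        exact hpq (by exact_mod_cast (Real.log_injOn_pos hp0 hq0 h.symm))
      have h1 := norm_integral_Ioo_exp_le (mul_ne_zero ht0.ne' hlog)
      rw [abs_mul, abs_of_pos ht0] at h1
      have h2 := mul_le_mul (hM p hp q hq) h1 (norm_nonneg _) (by positivity)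
      refine h2.trans (le_of_eq ?_)
      have := abs_pos.mpr hlog
      field_simp
      ring
  have hnorm : ∫ ω in Set.Ioo (0 : ℝ) 1,
          ‖∑ p ∈ S, a p * Complex.exp ((-(t * Real.log p) * ω : ℝ) * Complex.I)‖ ^ 2 ≤
      ∑ p ∈ S, ∑ q ∈ S, ((if p = q then ‖a p‖ ^ 2 else 0) + 2 / t * M ^ 2 * (if p = q then 0 else
        ((√p)⁻¹ * (√q)⁻¹) / |Real.log q - Real.log p|)) := by
    refine (le_abs_self _).trans ?_
    rw [← Real.norm_eq_abs, ← Complex.norm_real, hI]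
    refine (norm_sum_le _ _).trans (Finset.sum_le_sum fun p hp => ?_)
    exact (norm_sum_le _ _).trans (Finset.sum_le_sum fun q hq => hterm p hp q hq)
  refine hnorm.trans ?_
  simp_rw [Finset.sum_add_distrib, ← Finset.mul_sum]
  refine add_le_add (le_of_eq ?_) ?_
  · refine Finset.sum_congr rfl fun p hp => ?_
    rw [Finset.sum_ite_eq, if_pos hp]
  · calc _ ≤ 2 / t * M ^ 2 * (24 * t) := by
          gcongr
          exact ht S hS
      _ = 48 * M ^ 2 := by field_simp; ring

open Finset in
/-- Taylor's formula for the exponential on the imaginary axis, with the sharp remainder. -/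
lemma norm_exp_mul_I_sub_sum_le (n : ℕ) (x : ℝ) :
    ‖Complex.exp (x * Complex.I) - ∑ k ∈ range n, (x * Complex.I) ^ k / k.factorial‖
      ≤ |x| ^ n / n.factorial := by
  set F : ℕ → ℝ → ℂ := fun n x =>
    Complex.exp (x * Complex.I) - ∑ k ∈ range n, (x * Complex.I) ^ k / k.factorial with hF
  have hd0 : ∀ x : ℝ, HasDerivAt (fun x : ℝ => (x : ℂ) * Complex.I) Complex.I x := fun x => by
    simpa using (Complex.ofRealCLM.hasDerivAt (x := x)).mul_const Complex.I
  have hderiv : ∀ n x, HasDerivAt (F (n + 1)) (F n x * Complex.I) x := by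
    intro n x
    have h1 : HasDerivAt (fun x : ℝ => Complex.exp (x * Complex.I))
        (Complex.exp (x * Complex.I) * Complex.I) x := (hd0 x).cexp
    have h2 : HasDerivAt (fun x : ℝ => ∑ k ∈ range (n + 1), (x * Complex.I) ^ k / k.factorial)
        (∑ k ∈ range n, (x * Complex.I) ^ k / k.factorial * Complex.I) x := by
      simp_rw [sum_range_succ']
      simp only [pow_zero, Nat.factorial_zero, Nat.cast_one, div_one]
      refine HasDerivAt.add_const _ (HasDerivAt.fun_sum fun k _ => ?_)
      have := ((hd0 x).pow (k + 1)).div_const (((k + 1).factorial : ℕ) : ℂ)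
      convert! this using 1
      rw [Nat.factorial_succ]
      have : (k.factorial : ℂ) ≠ 0 := by exact_mod_cast k.factorial_ne_zero
      have : ((k : ℂ) + 1) ≠ 0 := by exact_mod_cast k.succ_ne_zero
      push_cast
      field_simp
    rw [hF]
    simp only
    rw [sub_mul, sum_mul]
    exact h1.sub h2
  have hpos : ∀ n, ∀ x : ℝ, 0 ≤ x → ‖F n x‖ ≤ x ^ n / n.factorial := by
    intro n
    induction n with
    | zero => intro x _; simp [hF, Complex.norm_exp]
    | succ n ih =>
      intro x hx
      have hB : ∀ y : ℝ, HasDerivAt (fun y : ℝ => y ^ (n + 1) / (n + 1).factorial)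
          (y ^ n / n.factorial) y := by
        intro y
        have := (hasDerivAt_pow (n + 1) y).div_const (((n + 1).factorial : ℕ) : ℝ)
        convert! this using 1
        rw [Nat.factorial_succ]
        have : (n.factorial : ℝ) ≠ 0 := by exact_mod_cast n.factorial_ne_zero
        push_cast
        field_simp
      refine image_norm_le_of_norm_deriv_right_le_deriv_boundary (a := 0) (b := x)
        (f' := fun y => F n y * Complex.I) (B' := fun y => y ^ n / n.factorial)
        (fun y _ => (hderiv n y).continuousAt.continuousWithinAt)
        (fun y _ => (hderiv n y).hasDerivWithinAt) ?_ hB ?_ ⟨hx, le_rfl⟩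
      · simp [hF, sum_range_succ']
      · intro y hy
        rw [norm_mul, Complex.norm_I, mul_one]
        exact ih y hy.1
  rcases le_total 0 x with hx | hx
  · rw [abs_of_nonneg hx]
    exact hpos n x hx
  · rw [abs_of_nonpos hx, ← RCLike.norm_conj]
    refine le_trans (le_of_eq ?_) (hpos n (-x) (by linarith))
    congr 1
    simp [hF, ← Complex.exp_conj]

section TrigonometricSums

variable {ι : Type*} [Fintype ι]

/-- The real part of a trigonometric sum with coefficients `b` and phases `x`. -/
noncomputable def trigSum (b : ι → ℂ) (x : ι → ℝ) : ℝ :=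
  (∑ i, b i * Complex.exp (x i * Complex.I)).re

lemma trigSum_eq_sum (b : ι → ℂ) (x : ι → ℝ) :
    trigSum b x = ∑ i, (b i * Complex.exp (x i * Complex.I)).re := by
  rw [trigSum, Complex.re_sum]

lemma continuous_trigSum (b : ι → ℂ) : Continuous (trigSum b) := by
  unfold trigSum
  fun_prop

lemma abs_trigSum_le (b : ι → ℂ) (x : ι → ℝ) : |trigSum b x| ≤ ∑ i, ‖b i‖ := by
  refine (Complex.abs_re_le_norm _).trans ((norm_sum_le _ _).trans (le_of_eq ?_))
  simp [Complex.norm_exp]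

/-- The sign attached to a boolean. -/
def boolSign (s : Bool) : ℤ := if s then 1 else -1

/-- The coefficients of a real trigonometric sum with respect to the characters. -/
noncomputable def trigCoeff (b : ι → ℂ) (x : ι × Bool) : ℂ :=
  if x.2 then b x.1 / 2 else conj (b x.1) / 2

lemma ofReal_trigSum (b : ι → ℂ) (x : ι → ℝ) :
    (trigSum b x : ℂ) = ∑ y : ι × Bool,
      trigCoeff b y * Complex.exp ((boolSign y.2 * x y.1 : ℝ) * Complex.I) := by
  rw [trigSum, Complex.re_eq_add_conj, map_sum, Fintype.sum_prod_type, ← Finset.sum_add_distrib,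
    Finset.sum_div]
  refine Finset.sum_congr rfl fun i _ => ?_
  simp only [Fintype.sum_bool, trigCoeff, boolSign, if_true, map_mul, ← Complex.exp_conj,
    Complex.conj_I, Complex.conj_ofReal]
  simp
  ring

lemma sum_norm_trigCoeff (b : ι → ℂ) : ∑ y, ‖trigCoeff b y‖ = ∑ i, ‖b i‖ := by
  rw [Fintype.sum_prod_type]
  refine Finset.sum_congr rfl fun i _ => ?_
  simp [trigCoeff]

variable [DecidableEq ι]

/-- The multiplicity of each frequency in a product of characters. -/
def freqVector {m : ℕ} (g : Fin m → ι × Bool) (i : ι) : ℤ :=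
  ∑ j, if (g j).1 = i then boolSign (g j).2 else 0

lemma sum_abs_freqVector_le {m : ℕ} (g : Fin m → ι × Bool) :
    ∑ i, |freqVector g i| ≤ m := by
  calc ∑ i, |freqVector g i| ≤ ∑ i, ∑ j, if (g j).1 = i then 1 else 0 := by
        refine Finset.sum_le_sum fun i _ => (Finset.abs_sum_le_sum_abs _ _).trans
          (Finset.sum_le_sum fun j _ => ?_)
        split_ifs
        · unfold boolSign
          split_ifs <;> simp
        · simp
    _ = ∑ j : Fin m, ∑ i, if (g j).1 = i then 1 else 0 := Finset.sum_comm
    _ = m := by simp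

lemma ofReal_trigSum_pow (b : ι → ℂ) (x : ι → ℝ) (m : ℕ) :
    (trigSum b x : ℂ) ^ m = ∑ g : Fin m → ι × Bool, (∏ j, trigCoeff b (g j)) *
      Complex.exp ((∑ i, freqVector g i * x i : ℝ) * Complex.I) := by
  rw [ofReal_trigSum, Fintype.sum_pow]
  refine Finset.sum_congr rfl fun g _ => ?_
  rw [Finset.prod_mul_distrib, ← Complex.exp_sum, ← Finset.sum_mul, ← Complex.ofReal_sum]
  congr 4
  simp only [freqVector, Int.cast_sum, Finset.sum_mul]
  rw [Finset.sum_comm]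
  refine Finset.sum_congr rfl fun j _ => ?_
  simp [Finset.sum_ite_eq]

variable {Ω Ω' : Type*} [MeasurableSpace Ω] [MeasurableSpace Ω'] {P : Measure Ω} {P' : Measure Ω'}
  [IsProbabilityMeasure P] [IsProbabilityMeasure P'] {X : Ω → ι → ℝ} {X' : Ω' → ι → ℝ}

omit [DecidableEq ι] in
lemma integrable_exp_mul_I {Y : Ω → ℝ} (hY : Measurable Y) :
    Integrable (fun ω => Complex.exp (Y ω * Complex.I)) P :=
  Integrable.of_bound (by fun_prop) 1 (by simp [Complex.norm_exp])

omit [DecidableEq ι] in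
lemma integrable_trigSum_pow (hX : Measurable X) (b : ι → ℂ) (m : ℕ) :
    Integrable (fun ω => trigSum b (X ω) ^ m) P := by
  refine Integrable.of_bound
    (((continuous_trigSum b).measurable.comp hX).pow_const m).aestronglyMeasurable
    ((∑ i, ‖b i‖) ^ m) (Eventually.of_forall fun ω => ?_)
  rw [norm_pow, Real.norm_eq_abs]
  exact pow_le_pow_left₀ (abs_nonneg _) (abs_trigSum_le b _) m

lemma integral_trigSum_pow (hX : Measurable X) (b : ι → ℂ) (m : ℕ) :
    ((∫ ω, trigSum b (X ω) ^ m ∂P : ℝ) : ℂ) = ∑ g : Fin m → ι × Bool, (∏ j, trigCoeff b (g j)) *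
      ∫ ω, Complex.exp ((∑ i, freqVector g i * X ω i : ℝ) * Complex.I) ∂P := by
  rw [← integral_complex_ofReal]
  simp_rw [Complex.ofReal_pow, ofReal_trigSum_pow]
  rw [integral_finsetSum]
  · simp_rw [integral_const_mul]
  · intro g _
    exact (integrable_exp_mul_I (by fun_prop)).const_mul _

/-- Moments of trigonometric sums are controlled by the joint Fourier coefficients of the
phases. -/
theorem abs_integral_trigSum_pow_sub_le (hX : Measurable X) (hX' : Measurable X') (b : ι → ℂ)
    (m : ℕ) {δ : ℝ}
    (h : ∀ k : ι → ℤ, ∑ i, |k i| ≤ m →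
      ‖∫ ω, Complex.exp ((∑ i, k i * X ω i : ℝ) * Complex.I) ∂P -
        ∫ ω, Complex.exp ((∑ i, k i * X' ω i : ℝ) * Complex.I) ∂P'‖ ≤ δ) :
    |∫ ω, trigSum b (X ω) ^ m ∂P - ∫ ω, trigSum b (X' ω) ^ m ∂P'| ≤ δ * (∑ i, ‖b i‖) ^ m := by
  rw [← Real.norm_eq_abs, ← Complex.norm_real, Complex.ofReal_sub, integral_trigSum_pow hX,
    integral_trigSum_pow hX', ← Finset.sum_sub_distrib, ← sum_norm_trigCoeff, Fintype.sum_pow,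
    Finset.mul_sum]
  refine (norm_sum_le _ _).trans (Finset.sum_le_sum fun g _ => ?_)
  rw [← mul_sub, norm_mul, norm_prod, mul_comm]
  gcongr
  exact h _ (sum_abs_freqVector_le g)

omit [DecidableEq ι] in
lemma norm_integral_exp_trigSum_sub_moments_le (hX : Measurable X) (b : ι → ℂ) (n : ℕ) :
    ‖∫ ω, Complex.exp (trigSum b (X ω) * Complex.I) ∂P - ∑ k ∈ Finset.range (2 * n),
        ((∫ ω, trigSum b (X ω) ^ k ∂P : ℝ) : ℂ) * (Complex.I ^ k / k.factorial)‖ ≤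
      (∫ ω, trigSum b (X ω) ^ (2 * n) ∂P) / (2 * n).factorial := by
  have hm : Measurable fun ω => trigSum b (X ω) := (continuous_trigSum b).measurable.comp hX
  have e1 : ∑ k ∈ Finset.range (2 * n),
      ((∫ ω, trigSum b (X ω) ^ k ∂P : ℝ) : ℂ) * (Complex.I ^ k / k.factorial) =
      ∫ ω, ∑ k ∈ Finset.range (2 * n),
        ((trigSum b (X ω) : ℂ) * Complex.I) ^ k / k.factorial ∂P := by
    rw [integral_finsetSum]
    · refine Finset.sum_congr rfl fun k _ => ?_
      rw [← integral_complex_ofReal, ← integral_mul_const]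
      congr 1
      ext ω
      rw [mul_pow]
      push_cast
      ring
    · intro k _
      have := ((integrable_trigSum_pow (P := P) hX b k).ofReal (𝕜 := ℂ)).mul_const
        (Complex.I ^ k / k.factorial)
      refine this.congr (Eventually.of_forall fun ω => ?_)
      simp [mul_pow]
      ring
  have hint2 : Integrable (fun ω => ∑ k ∈ Finset.range (2 * n),
        ((trigSum b (X ω) : ℂ) * Complex.I) ^ k / k.factorial) P := by
    refine integrable_finsetSum _ fun k _ => ?_
    have := ((integrable_trigSum_pow (P := P) hX b k).ofReal (𝕜 := ℂ)).mul_const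
        (Complex.I ^ k / k.factorial)
    refine this.congr (Eventually.of_forall fun ω => ?_)
    simp [mul_pow]
    ring
  rw [e1, ← integral_sub (integrable_exp_mul_I hm) hint2, ← integral_div]
  refine norm_integral_le_of_norm_le ((integrable_trigSum_pow hX b (2 * n)).div_const _)
    (Eventually.of_forall fun ω => ?_)
  refine (norm_exp_mul_I_sub_sum_le (2 * n) _).trans (le_of_eq ?_)
  rw [Even.pow_abs (even_two_mul n)]

/-- Comparison of characteristic functions of trigonometric sums whose phases have nearly the same
joint Fourier coefficients of low order. -/
theorem norm_integral_exp_trigSum_sub_le (hX : Measurable X) (hX' : Measurable X') (b : ι → ℂ)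
    (n : ℕ) {δ β : ℝ} (hδ : 0 ≤ δ) (hβ : 1 ≤ β) (hb : ∑ i, ‖b i‖ ≤ β)
    (h : ∀ k : ι → ℤ, ∑ i, |k i| ≤ (2 * n : ℕ) →
      ‖∫ ω, Complex.exp ((∑ i, k i * X ω i : ℝ) * Complex.I) ∂P -
        ∫ ω, Complex.exp ((∑ i, k i * X' ω i : ℝ) * Complex.I) ∂P'‖ ≤ δ) :
    ‖∫ ω, Complex.exp (trigSum b (X ω) * Complex.I) ∂P -
        ∫ ω, Complex.exp (trigSum b (X' ω) * Complex.I) ∂P'‖ ≤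
      (2 * n + 1) * δ * β ^ (2 * n) +
        2 * ((∫ ω, trigSum b (X' ω) ^ (2 * n) ∂P') / (2 * n).factorial) := by
  have hmom : ∀ m ≤ 2 * n,
      |∫ ω, trigSum b (X ω) ^ m ∂P - ∫ ω, trigSum b (X' ω) ^ m ∂P'| ≤ δ * β ^ (2 * n) := by
    intro m hm
    refine (abs_integral_trigSum_pow_sub_le hX hX' b m
      (fun k hk => h k (hk.trans (by exact_mod_cast hm)))).trans ?_
    gcongr
    exact (pow_le_pow_left₀ (Finset.sum_nonneg fun _ _ => norm_nonneg _) hb m).trans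
      (pow_le_pow_right₀ hβ hm)
  have hA := norm_integral_exp_trigSum_sub_moments_le (P := P) hX b n
  have hA' := norm_integral_exp_trigSum_sub_moments_le (P := P') hX' b n
  set φ := ∫ ω, Complex.exp (trigSum b (X ω) * Complex.I) ∂P
  set φ' := ∫ ω, Complex.exp (trigSum b (X' ω) * Complex.I) ∂P'
  set T := ∑ k ∈ Finset.range (2 * n),
        ((∫ ω, trigSum b (X ω) ^ k ∂P : ℝ) : ℂ) * (Complex.I ^ k / k.factorial)
  set T' := ∑ k ∈ Finset.range (2 * n),
        ((∫ ω, trigSum b (X' ω) ^ k ∂P' : ℝ) : ℂ) * (Complex.I ^ k / k.factorial)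
  have hTT : ‖T - T'‖ ≤ 2 * n * (δ * β ^ (2 * n)) := by
    rw [← Finset.sum_sub_distrib]
    refine (norm_sum_le _ _).trans ?_
    calc _ ≤ ∑ k ∈ Finset.range (2 * n), δ * β ^ (2 * n) := by
          refine Finset.sum_le_sum fun k hk => ?_
          rw [← sub_mul, ← Complex.ofReal_sub, norm_mul, Complex.norm_real, Real.norm_eq_abs]
          have h1 : ‖Complex.I ^ k / (k.factorial : ℂ)‖ ≤ 1 := by
            rw [norm_div, norm_pow, Complex.norm_I, one_pow, Complex.norm_natCast]
            exact div_le_one_of_le₀ (by exact_mod_cast k.factorial_pos) (by positivity)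
          exact (mul_le_of_le_one_right (abs_nonneg _) h1).trans
            (hmom k (Finset.mem_range.mp hk).le)
      _ = _ := by simp
  have hlast := hmom (2 * n) le_rfl
  have hf : (1 : ℝ) ≤ (2 * n).factorial := by exact_mod_cast (2 * n).factorial_pos
  have hfin : (∫ ω, trigSum b (X ω) ^ (2 * n) ∂P) / (2 * n).factorial ≤
      (∫ ω, trigSum b (X' ω) ^ (2 * n) ∂P') / (2 * n).factorial + δ * β ^ (2 * n) := by
    have h0 : 0 ≤ δ * β ^ (2 * n) := by positivity
    have h2 := (abs_le.mp hlast).2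
    calc (∫ ω, trigSum b (X ω) ^ (2 * n) ∂P) / (2 * n).factorial
        ≤ ((∫ ω, trigSum b (X' ω) ^ (2 * n) ∂P') + δ * β ^ (2 * n)) / (2 * n).factorial := by
          gcongr
          linarith
      _ = (∫ ω, trigSum b (X' ω) ^ (2 * n) ∂P') / (2 * n).factorial
          + δ * β ^ (2 * n) / (2 * n).factorial := add_div _ _ _
      _ ≤ _ := by
          gcongr
          exact div_le_self h0 hf
  calc ‖φ - φ'‖ = ‖(φ - T) + (T - T') - (φ' - T')‖ := by ring_nf
    _ ≤ ‖φ - T‖ + ‖T - T'‖ + ‖φ' - T'‖ := (norm_sub_le _ _).trans (by gcongr; exact norm_add_le _ _)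
    _ ≤ _ := by linarith

end TrigonometricSums

section Steinhaus

/-- The uniform measure on the unit interval. -/
noncomputable def unitMeasure : Measure ℝ := volume.restrict (Set.Ioo 0 1)

instance : IsProbabilityMeasure unitMeasure := ⟨by simp [unitMeasure]⟩

/-- The phase of a Steinhaus variable. -/
noncomputable def steinhausPhase (θ : ℝ) : ℝ := 2 * Real.pi * θ

lemma continuous_steinhausPhase : Continuous steinhausPhase := by
  unfold steinhausPhase
  fun_prop

lemma integral_exp_steinhausPhase (k : ℤ) :
    ∫ θ, Complex.exp ((k * steinhausPhase θ : ℝ) * Complex.I) ∂unitMeasure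
      = if k = 0 then 1 else 0 := by
  split_ifs with hk
  · simp [hk]
  · rw [unitMeasure, ← integral_Ioc_eq_integral_Ioo, ← intervalIntegral.integral_of_le zero_le_one]
    have hc : (k : ℂ) * (2 * Real.pi * Complex.I) ≠ 0 :=
      mul_ne_zero (by exact_mod_cast hk) Complex.two_pi_I_ne_zero
    have h2 : ∀ θ : ℝ, Complex.exp ((k * steinhausPhase θ : ℝ) * Complex.I)
        = Complex.exp ((k : ℂ) * (2 * Real.pi * Complex.I) * θ) := by
      intro θ
      rw [steinhausPhase]
      congr 1
      push_cast
      ring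
    simp_rw [h2]
    rw [integral_exp_mul_complex hc]
    simp [Complex.exp_int_mul_two_pi_mul_I]

/-- The real part of a multiple of a Steinhaus variable. -/
noncomputable def steinhausRe (b : ℂ) (θ : ℝ) : ℝ :=
  (b * Complex.exp (steinhausPhase θ * Complex.I)).re

lemma continuous_steinhausRe (b : ℂ) : Continuous (steinhausRe b) := by
  have := continuous_steinhausPhase
  unfold steinhausRe
  fun_prop

lemma abs_steinhausRe_le (b : ℂ) (θ : ℝ) : |steinhausRe b θ| ≤ ‖b‖ :=
  (Complex.abs_re_le_norm _).trans (by simp [Complex.norm_exp])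

lemma integrable_steinhausRe_pow (b : ℂ) (m : ℕ) :
    Integrable (fun θ => steinhausRe b θ ^ m) unitMeasure := by
  refine Integrable.of_bound ((continuous_steinhausRe b).pow m).aestronglyMeasurable (‖b‖ ^ m)
    (Eventually.of_forall fun θ => ?_)
  rw [norm_pow, Real.norm_eq_abs]
  exact pow_le_pow_left₀ (abs_nonneg _) (abs_steinhausRe_le b θ) m

lemma integrable_exp_steinhausPhase (k : ℤ) :
    Integrable (fun θ => Complex.exp ((k * steinhausPhase θ : ℝ) * Complex.I)) unitMeasure :=
  integrable_exp_mul_I (continuous_const.mul continuous_steinhausPhase).measurable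

lemma integral_steinhausRe (b : ℂ) : ∫ θ, steinhausRe b θ ∂unitMeasure = 0 := by
  have h1 := integral_exp_steinhausPhase 1
  have h2 := (integrable_exp_steinhausPhase 1).const_mul b
  simp only [Int.cast_one, one_mul, one_ne_zero, if_false] at h1 h2
  have h3 := integral_re (𝕜 := ℂ) h2
  rw [integral_const_mul, h1, mul_zero] at h3
  exact h3.trans Complex.zero_re

lemma integral_steinhausRe_sq (b : ℂ) :
    ∫ θ, steinhausRe b θ ^ 2 ∂unitMeasure = ‖b‖ ^ 2 / 2 := by
  have h1 := integral_exp_steinhausPhase 2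
  have h2 := (integrable_exp_steinhausPhase 2).const_mul (b ^ 2)
  simp only [OfNat.ofNat_ne_zero, if_false] at h1
  have h3 := integral_re (𝕜 := ℂ) h2
  rw [integral_const_mul, h1, mul_zero] at h3
  have h4 : ∀ θ, steinhausRe b θ ^ 2 = ‖b‖ ^ 2 / 2 + (b ^ 2 *
      Complex.exp (((2 : ℤ) * steinhausPhase θ : ℝ) * Complex.I)).re / 2 := by
    intro θ
    set z := b * Complex.exp (steinhausPhase θ * Complex.I) with hz
    have h5 : b ^ 2 * Complex.exp (((2 : ℤ) * steinhausPhase θ : ℝ) * Complex.I) = z ^ 2 := by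
      rw [hz, mul_pow, ← Complex.exp_nat_mul]
      congr 2
      push_cast
      ring
    have h6 : ‖b‖ = ‖z‖ := by simp [hz, Complex.norm_exp]
    have h7 : steinhausRe b θ = z.re := rfl
    have h8 : (z ^ 2).re = z.re * z.re - z.im * z.im := by rw [sq, Complex.mul_re]
    rw [h5, h6, h7, h8, ← Complex.normSq_eq_norm_sq, Complex.normSq_apply]
    ring
  have h9 : Integrable (fun θ => (b ^ 2 *
      Complex.exp (((2 : ℤ) * steinhausPhase θ : ℝ) * Complex.I)).re) unitMeasure := h2.re
  simp_rw [h4]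
  rw [integral_add (integrable_const _) (h9.div_const 2), integral_const, integral_div]
  have h7 : ∫ θ, (b ^ 2 *
      Complex.exp (((2 : ℤ) * steinhausPhase θ : ℝ) * Complex.I)).re ∂unitMeasure = 0 := h3.trans Complex.zero_re
  rw [h7]
  simp

lemma integral_exp_steinhausRe_le (b : ℂ) (c : ℝ) :
    ∫ θ, Real.exp (c * steinhausRe b θ) ∂unitMeasure ≤ Real.exp (c ^ 2 * ‖b‖ ^ 2 / 2) := by
  have h := (ProbabilityTheory.hasSubgaussianMGF_of_mem_Icc_of_integral_eq_zero
    (X := steinhausRe b) (μ := unitMeasure) (a := -‖b‖) (b := ‖b‖)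
    (continuous_steinhausRe b).measurable.aemeasurable
    (Eventually.of_forall fun θ => abs_le.mp (abs_steinhausRe_le b θ))
    (integral_steinhausRe b)).mgf_le c
  refine h.trans (le_of_eq ?_)
  congr 1
  have : ‖‖b‖ - -‖b‖‖ = 2 * ‖b‖ := by
    rw [Real.norm_of_nonneg (by linarith [norm_nonneg b])]
    ring
  push_cast
  rw [this]
  ring

lemma norm_integral_exp_steinhausRe_sub_le {b : ℂ} (hb : ‖b‖ ≤ 1) :
    ‖∫ θ, Complex.exp (steinhausRe b θ * Complex.I) ∂unitMeasure -
      Complex.exp (-(‖b‖ ^ 2 / 4 : ℝ))‖ ≤ 2 * ‖b‖ ^ 3 := by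
  have hI : Integrable (fun θ => Complex.exp (steinhausRe b θ * Complex.I)) unitMeasure :=
    integrable_exp_mul_I (continuous_steinhausRe b).measurable
  have i1 : Integrable (fun θ => (steinhausRe b θ : ℂ) * Complex.I) unitMeasure := by
    simpa using! ((integrable_steinhausRe_pow b 1).ofReal (𝕜 := ℂ)).mul_const Complex.I
  have i2 : Integrable (fun θ => ((steinhausRe b θ ^ 2 : ℝ) : ℂ) / 2) unitMeasure :=
    ((integrable_steinhausRe_pow b 2).ofReal (𝕜 := ℂ)).div_const 2
  have i3 : Integrable (fun θ => 1 + (steinhausRe b θ : ℂ) * Complex.I) unitMeasure :=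
    (integrable_const _).add i1
  have i4 : Integrable (fun θ => 1 + (steinhausRe b θ : ℂ) * Complex.I -
      ((steinhausRe b θ ^ 2 : ℝ) : ℂ) / 2) unitMeasure := i3.sub i2
  have e1 : ∫ θ, (1 + (steinhausRe b θ : ℂ) * Complex.I -
      ((steinhausRe b θ ^ 2 : ℝ) : ℂ) / 2) ∂unitMeasure = ((1 - ‖b‖ ^ 2 / 4 : ℝ) : ℂ) := by
    rw [integral_sub i3 i2, integral_add (integrable_const _) i1, integral_mul_const,
      integral_div, integral_complex_ofReal, integral_complex_ofReal, integral_steinhausRe,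
      integral_steinhausRe_sq]
    simp
    ring
  have h1 : ‖∫ θ, Complex.exp (steinhausRe b θ * Complex.I) ∂unitMeasure -
      ((1 - ‖b‖ ^ 2 / 4 : ℝ) : ℂ)‖ ≤ ‖b‖ ^ 3 := by
    rw [← e1, ← integral_sub hI i4]
    have := norm_integral_le_of_norm_le_const (μ := unitMeasure) (C := ‖b‖ ^ 3)
      (f := fun θ => Complex.exp (steinhausRe b θ * Complex.I) -
        (1 + (steinhausRe b θ : ℂ) * Complex.I - ((steinhausRe b θ ^ 2 : ℝ) : ℂ) / 2))
      (Eventually.of_forall fun θ => ?_)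
    · simpa using this
    · have h := norm_exp_mul_I_sub_sum_le 3 (steinhausRe b θ)
      have e : ∑ k ∈ Finset.range 3, ((steinhausRe b θ : ℂ) * Complex.I) ^ k / k.factorial =
          1 + (steinhausRe b θ : ℂ) * Complex.I - ((steinhausRe b θ ^ 2 : ℝ) : ℂ) / 2 := by
        simp [Finset.sum_range_succ, mul_pow, Complex.I_sq]
        ring
      rw [e] at h
      refine h.trans ?_
      calc |steinhausRe b θ| ^ 3 / (Nat.factorial 3 : ℕ) ≤ |steinhausRe b θ| ^ 3 :=
            div_le_self (by positivity) (by exact_mod_cast (Nat.factorial_pos 3))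
        _ ≤ ‖b‖ ^ 3 := pow_le_pow_left₀ (abs_nonneg _) (abs_steinhausRe_le b θ) 3
  have h2 : ‖((1 - ‖b‖ ^ 2 / 4 : ℝ) : ℂ) - Complex.exp (-(‖b‖ ^ 2 / 4 : ℝ))‖ ≤ ‖b‖ ^ 3 := by
    rw [← Complex.ofReal_neg, ← Complex.ofReal_exp, ← Complex.ofReal_sub, Complex.norm_real,
      norm_sub_rev, Real.norm_eq_abs]
    have h0 := norm_nonneg b
    have hb2 : ‖b‖ ^ 2 ≤ 1 := pow_le_one₀ h0 hb
    have := Real.abs_exp_sub_one_sub_id_le (x := -(‖b‖ ^ 2 / 4)) (by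
      rw [abs_neg, abs_of_nonneg (by positivity)]
      linarith)
    have e : Real.exp (-(‖b‖ ^ 2 / 4)) - (1 - ‖b‖ ^ 2 / 4) =
      Real.exp (-(‖b‖ ^ 2 / 4)) - 1 - -(‖b‖ ^ 2 / 4) := by ring
    rw [e]
    refine this.trans ?_
    have h3 : 0 ≤ ‖b‖ ^ 3 := by positivity
    nlinarith
  calc _ ≤ _ + _ := norm_sub_le_norm_sub_add_norm_sub _ ((1 - ‖b‖ ^ 2 / 4 : ℝ) : ℂ) _
    _ ≤ _ := by linarith

lemma norm_prod_sub_prod_le_sum {ι : Type*} (s : Finset ι) (u v : ι → ℂ)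
    (hu : ∀ i ∈ s, ‖u i‖ ≤ 1) (hv : ∀ i ∈ s, ‖v i‖ ≤ 1) :
    ‖∏ i ∈ s, u i - ∏ i ∈ s, v i‖ ≤ ∑ i ∈ s, ‖u i - v i‖ := by
  classical
  induction s using Finset.induction_on with
  | empty => simp
  | insert i s hi ih =>
    rw [Finset.prod_insert hi, Finset.prod_insert hi, Finset.sum_insert hi]
    have h1 := ih (fun j hj => hu j (Finset.mem_insert_of_mem hj))
      (fun j hj => hv j (Finset.mem_insert_of_mem hj))
    have h2 : ‖∏ j ∈ s, u j‖ ≤ 1 := by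
      rw [norm_prod]
      exact Finset.prod_le_one (fun _ _ => norm_nonneg _)
        fun j hj => hu j (Finset.mem_insert_of_mem hj)
    have h3 := hv i (Finset.mem_insert_self i s)
    calc ‖u i * ∏ j ∈ s, u j - v i * ∏ j ∈ s, v j‖
        = ‖(u i - v i) * ∏ j ∈ s, u j + v i * (∏ j ∈ s, u j - ∏ j ∈ s, v j)‖ := by ring_nf
      _ ≤ ‖u i - v i‖ * ‖∏ j ∈ s, u j‖ + ‖v i‖ * ‖∏ j ∈ s, u j - ∏ j ∈ s, v j‖ := by
          refine (norm_add_le _ _).trans ?_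
          rw [norm_mul, norm_mul]
      _ ≤ ‖u i - v i‖ * 1 + 1 * ∑ j ∈ s, ‖u j - v j‖ := by gcongr
      _ = _ := by ring

variable {ι : Type*}

/-- The phases of a finite family of independent Steinhaus variables. -/
noncomputable def steinhausPhases (θ : ι → ℝ) (i : ι) : ℝ := steinhausPhase (θ i)

lemma continuous_steinhausPhases : Continuous (steinhausPhases (ι := ι)) :=
  continuous_pi fun i => continuous_steinhausPhase.comp (continuous_apply i)

variable [Fintype ι]

/-- The law of a finite family of independent uniform variables. -/
noncomputable def cubeMeasure (ι : Type*) [Fintype ι] : Measure (ι → ℝ) :=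
  Measure.pi fun _ => unitMeasure

instance : IsProbabilityMeasure (cubeMeasure ι) := by
  unfold cubeMeasure
  infer_instance

lemma trigSum_steinhausPhases (b : ι → ℂ) (θ : ι → ℝ) :
    trigSum b (steinhausPhases θ) = ∑ i, steinhausRe (b i) (θ i) :=
  trigSum_eq_sum _ _

lemma integral_exp_sum_steinhausPhases (k : ι → ℤ) :
    ∫ θ, Complex.exp ((∑ i, k i * steinhausPhases θ i : ℝ) * Complex.I) ∂(cubeMeasure ι)
      = if k = 0 then 1 else 0 := by
  have h : ∀ θ : ι → ℝ, Complex.exp ((∑ i, k i * steinhausPhases θ i : ℝ) * Complex.I) =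
      ∏ i, Complex.exp ((k i * steinhausPhase (θ i) : ℝ) * Complex.I) := by
    intro θ
    rw [← Complex.exp_sum, Complex.ofReal_sum, Finset.sum_mul]
    rfl
  simp_rw [h]
  rw [cubeMeasure, integral_fintype_prod_eq_prod
    (f := fun i θ => Complex.exp ((k i * steinhausPhase θ : ℝ) * Complex.I))]
  simp_rw [integral_exp_steinhausPhase]
  split_ifs with hk
  · simp [hk]
  · obtain ⟨i, hi⟩ := Function.ne_iff.mp hk
    exact Finset.prod_eq_zero (Finset.mem_univ i) (if_neg hi)

lemma integral_exp_trigSum_steinhausPhases_le (b : ι → ℂ) (c : ℝ) :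
    ∫ θ, Real.exp (c * trigSum b (steinhausPhases θ)) ∂(cubeMeasure ι) ≤
      Real.exp (c ^ 2 * (∑ i, ‖b i‖ ^ 2) / 2) := by
  simp_rw [trigSum_steinhausPhases, Finset.mul_sum, Real.exp_sum]
  rw [cubeMeasure, integral_fintype_prod_eq_prod
    (f := fun i θ => Real.exp (c * steinhausRe (b i) θ)), Finset.sum_div, Real.exp_sum]
  exact Finset.prod_le_prod (fun i _ => integral_nonneg fun _ => (Real.exp_pos _).le)
    fun i _ => integral_exp_steinhausRe_le (b i) c

lemma pow_div_factorial_le_exp_add_exp (n : ℕ) (y : ℝ) :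
    y ^ (2 * n) / (2 * n).factorial ≤ Real.exp y + Real.exp (-y) := by
  have h := Real.pow_div_factorial_le_exp |y| (abs_nonneg y) (2 * n)
  rw [Even.pow_abs (even_two_mul n)] at h
  rcases abs_cases y with ⟨h1, _⟩ | ⟨h1, _⟩ <;> rw [h1] at h
  · linarith [Real.exp_pos (-y)]
  · linarith [Real.exp_pos y]

/-- Moments of Steinhaus sums grow at most like Gaussian moments. -/
lemma integral_trigSum_steinhausPhases_pow_le (b : ι → ℂ) (n : ℕ) :
    (∫ θ, trigSum b (steinhausPhases θ) ^ (2 * n) ∂(cubeMeasure ι)) / (2 * n).factorial ≤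
      2 * Real.exp (2 * ∑ i, ‖b i‖ ^ 2) / 4 ^ n := by
  have hm := (continuous_trigSum b).comp (continuous_steinhausPhases (ι := ι))
  have hexpint : ∀ c : ℝ, Integrable (fun θ => Real.exp (c * trigSum b (steinhausPhases θ)))
      (cubeMeasure ι) := by
    intro c
    refine Integrable.of_bound (Real.continuous_exp.comp
      (continuous_const.mul hm)).aestronglyMeasurable (Real.exp (|c| * ∑ i, ‖b i‖))
      (Eventually.of_forall fun θ => ?_)
    rw [Real.norm_of_nonneg (Real.exp_pos _).le, Real.exp_le_exp]
    refine (le_abs_self _).trans ?_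
    rw [abs_mul]
    gcongr
    exact abs_trigSum_le b _
  have h1 : (∫ θ, trigSum b (steinhausPhases θ) ^ (2 * n) ∂(cubeMeasure ι)) / (2 * n).factorial
      * 4 ^ n ≤ ∫ θ, (Real.exp (2 * trigSum b (steinhausPhases θ)) +
        Real.exp (-2 * trigSum b (steinhausPhases θ))) ∂(cubeMeasure ι) := by
    rw [← integral_div, ← integral_mul_const]
    refine integral_mono (((integrable_trigSum_pow continuous_steinhausPhases.measurable b
      (2 * n)).div_const _).mul_const _) ((hexpint 2).add (hexpint (-2))) fun θ => ?_
    have := pow_div_factorial_le_exp_add_exp n (2 * trigSum b (steinhausPhases θ))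
    rw [mul_pow, pow_mul 2, show (2 : ℝ) ^ 2 = 4 by norm_num] at this
    simp only
    rw [neg_mul]
    refine le_trans (le_of_eq ?_) this
    ring
  rw [integral_add (hexpint 2) (hexpint (-2))] at h1
  have h2 := integral_exp_trigSum_steinhausPhases_le b 2
  have h3 := integral_exp_trigSum_steinhausPhases_le b (-2)
  rw [le_div_iff₀ (by positivity)]
  have e : ((2 : ℝ)) ^ 2 * (∑ i, ‖b i‖ ^ 2) / 2 = 2 * ∑ i, ‖b i‖ ^ 2 := by ring
  have e' : ((-2 : ℝ)) ^ 2 * (∑ i, ‖b i‖ ^ 2) / 2 = 2 * ∑ i, ‖b i‖ ^ 2 := by ring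
  rw [e] at h2
  rw [e'] at h3
  linarith

/-- The characteristic function of a Steinhaus sum is close to a Gaussian one. -/
lemma norm_integral_exp_trigSum_steinhausPhases_sub_le {b : ι → ℂ} (hb : ∀ i, ‖b i‖ ≤ 1) :
    ‖∫ θ, Complex.exp (trigSum b (steinhausPhases θ) * Complex.I) ∂(cubeMeasure ι) -
      Complex.exp (-((∑ i, ‖b i‖ ^ 2) / 4 : ℝ))‖ ≤ 2 * ∑ i, ‖b i‖ ^ 3 := by
  simp_rw [trigSum_steinhausPhases, Complex.ofReal_sum, Finset.sum_mul, Complex.exp_sum]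
  rw [cubeMeasure, integral_fintype_prod_eq_prod
    (f := fun i θ => Complex.exp ((steinhausRe (b i) θ : ℂ) * Complex.I))]
  have e : Complex.exp (-((∑ i, ‖b i‖ ^ 2) / 4 : ℝ)) =
      ∏ i, Complex.exp (-(‖b i‖ ^ 2 / 4 : ℝ)) := by
    rw [← Complex.exp_sum, Finset.sum_div, Complex.ofReal_sum, Finset.sum_neg_distrib]
  rw [e, Finset.mul_sum]
  refine (norm_prod_sub_prod_le_sum _ _ _ (fun i _ => ?_) fun i _ => ?_).trans
    (Finset.sum_le_sum fun i _ => norm_integral_exp_steinhausRe_sub_le (hb i))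
  · have := norm_integral_le_of_norm_le_const (μ := unitMeasure) (C := 1)
      (f := fun θ => Complex.exp ((steinhausRe (b i) θ : ℂ) * Complex.I))
      (Eventually.of_forall fun θ => by simp [Complex.norm_exp])
    simpa using this
  · rw [← Complex.ofReal_neg, ← Complex.ofReal_exp, Complex.norm_real,
      Real.norm_of_nonneg (Real.exp_pos _).le, Real.exp_le_one_iff]
    have : 0 ≤ ‖b i‖ ^ 2 := by positivity
    linarith

end Steinhaus

section PrimeFrequencies

lemma inv_le_abs_log_sub_log {A B : ℕ} (hA : 0 < A) (hB : 0 < B) (h : A ≠ B) {X : ℝ}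
    (hAX : (A : ℝ) ≤ X) (hBX : (B : ℝ) ≤ X) : X⁻¹ ≤ |Real.log A - Real.log B| := by
  wlog hAB : A < B generalizing A B
  · rw [abs_sub_comm]
    exact this hB hA h.symm hBX hAX (lt_of_le_of_ne (not_lt.mp hAB) h.symm)
  have hA' : (0 : ℝ) < A := by exact_mod_cast hA
  have hB' : (0 : ℝ) < B := by exact_mod_cast hB
  have h1 : (A : ℝ) + 1 ≤ B := by exact_mod_cast hAB
  have h2 := Real.log_le_sub_one_of_pos (div_pos hA' hB')
  rw [Real.log_div hA'.ne' hB'.ne'] at h2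
  have h3 : X⁻¹ ≤ (B : ℝ)⁻¹ := inv_anti₀ hB' hBX
  have h4 : (B : ℝ)⁻¹ ≤ 1 - A / B := by
    rw [inv_eq_one_div, div_le_iff₀ hB', sub_mul, div_mul_cancel₀ _ hB'.ne']
    linarith
  rw [abs_sub_comm]
  exact le_trans (by linarith) (le_abs_self _)

lemma factorization_prod_primes_pow {S : Finset ℕ} (hS : ∀ p ∈ S, p.Prime) (e : S → ℕ) (q : S) :
    (∏ p : S, (p : ℕ) ^ e p).factorization q = e q := by
  rw [Nat.factorization_prod fun (p : S) _ => pow_ne_zero _ (hS p p.2).ne_zero, Finsupp.finsetSum_apply,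
    Finset.sum_eq_single q]
  · simp [(hS q q.2).factorization]
  · intro p _ hpq
    rw [Nat.Prime.factorization_pow (hS p p.2), Finsupp.single_apply, if_neg]
    exact fun h => hpq (Subtype.ext h)
  · simp

/-- Small integer combinations of logarithms of primes are not too close to zero. -/
lemma inv_pow_le_abs_sum_log_primes {S : Finset ℕ} (hS : ∀ p ∈ S, p.Prime) {N : ℝ} (hN : 1 ≤ N)
    (hSN : ∀ p ∈ S, (p : ℝ) ≤ N) {m : ℕ} {k : S → ℤ} (hk : k ≠ 0) (hkm : ∑ p, |k p| ≤ m) :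
    (N ^ m)⁻¹ ≤ |∑ p : S, (k p : ℝ) * Real.log p| := by
  have hlog : ∀ e : S → ℕ, Real.log ((∏ p : S, (p : ℕ) ^ e p : ℕ) : ℝ) =
      ∑ p : S, (e p : ℝ) * Real.log p := by
    intro e
    push_cast
    rw [Real.log_prod fun p _ => pow_ne_zero _ (by exact_mod_cast (hS p p.2).ne_zero)]
    simp
  have hpos : ∀ e : S → ℕ, 0 < ∏ p : S, (p : ℕ) ^ e p := fun e =>
    Finset.prod_pos fun p _ => pow_pos (hS p p.2).pos _
  have hle : ∀ e : S → ℕ, (∀ p, (e p : ℤ) ≤ |k p|) →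
      ((∏ p : S, (p : ℕ) ^ e p : ℕ) : ℝ) ≤ N ^ m := by
    intro e he
    push_cast
    calc ∏ p : S, (p : ℝ) ^ e p ≤ ∏ p : S, N ^ e p :=
          Finset.prod_le_prod (fun _ _ => by positivity)
            fun p _ => pow_le_pow_left₀ (by positivity) (hSN p p.2) _
      _ = N ^ ∑ p, e p := Finset.prod_pow_eq_pow_sum _ _ _
      _ ≤ N ^ m := by
          refine pow_le_pow_right₀ hN ?_
          have := (Finset.sum_le_sum fun p (_ : p ∈ Finset.univ) => he p).trans hkm
          exact_mod_cast this
  have hne : ∏ p : S, (p : ℕ) ^ (k p).toNat ≠ ∏ p : S, (p : ℕ) ^ (-k p).toNat := by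
    intro h
    refine hk (funext fun p => ?_)
    have := congrArg (fun n => n.factorization p) h
    rw [factorization_prod_primes_pow hS (fun p => (k p).toNat),
      factorization_prod_primes_pow hS (fun p => (-k p).toNat)] at this
    simp only [Pi.zero_apply]
    omega
  refine (inv_le_abs_log_sub_log (hpos _) (hpos _) hne (hle _ fun p => ?_)
    (hle _ fun p => ?_)).trans (le_of_eq ?_)
  · rw [Int.toNat_eq_max]
    exact max_le (le_abs_self _) (abs_nonneg _)
  · rw [Int.toNat_eq_max]
    exact max_le (neg_le_abs _) (abs_nonneg _)
  · rw [hlog fun p => (k p).toNat, hlog fun p => (-k p).toNat, ← Finset.sum_sub_distrib]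
    congr 1
    refine Finset.sum_congr rfl fun p _ => ?_
    rw [← sub_mul]
    congr 1
    exact_mod_cast (Int.toNat_sub_toNat_neg (k p))

/-- The characteristic function of a short Dirichlet polynomial over primes at a uniform random
height is close to a Gaussian one. -/
theorem norm_integral_exp_sum_primes_sub_le {S : Finset ℕ} (hS : ∀ p ∈ S, p.Prime) {N : ℝ}
    (hN : 1 ≤ N) (hSN : ∀ p ∈ S, (p : ℝ) ≤ N) {t : ℝ} (ht : 0 < t) {b : ℕ → ℂ}
    (hb : ∀ p ∈ S, ‖b p‖ ≤ 1) (n : ℕ) :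
    ‖∫ ω, Complex.exp ((∑ p ∈ S, b p *
          Complex.exp ((-(t * Real.log p) * ω : ℝ) * Complex.I)).re * Complex.I) ∂unitMeasure -
        Complex.exp (-((∑ p ∈ S, ‖b p‖ ^ 2) / 4 : ℝ))‖ ≤
      (2 * n + 1) * (2 * N ^ (2 * n) / t) * N ^ (2 * n) +
        4 * Real.exp (2 * ∑ p ∈ S, ‖b p‖ ^ 2) / 4 ^ n + 2 * ∑ p ∈ S, ‖b p‖ ^ 3 := by
  have hN0 : 0 < N := by linarith
  set X : ℝ → S → ℝ := fun ω p => -(t * Real.log p) * ω with hX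
  have hXm : Measurable X := by
    refine measurable_pi_lambda _ fun p => ?_
    fun_prop
  have e0 : ∀ ω, (∑ p ∈ S, b p * Complex.exp ((-(t * Real.log p) * ω : ℝ) * Complex.I)).re =
      trigSum (fun p : S => b p) (X ω) := by
    intro ω
    rw [trigSum, ← Finset.sum_coe_sort]
  have e2 : ∑ p ∈ S, ‖b p‖ ^ 2 = ∑ p : S, ‖b p‖ ^ 2 := (Finset.sum_coe_sort S _).symm
  have e3 : ∑ p ∈ S, ‖b p‖ ^ 3 = ∑ p : S, ‖b p‖ ^ 3 := (Finset.sum_coe_sort S _).symm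
  simp_rw [e0]
  rw [e2, e3]
  have hsum : ∑ p : S, ‖b p‖ ≤ N := by
    have hcard : (S.card : ℝ) ≤ N := by
      have : S ⊆ Finset.Icc 1 ⌊N⌋₊ := fun p hp =>
        Finset.mem_Icc.mpr ⟨(hS p hp).one_le, Nat.le_floor (hSN p hp)⟩
      have h1 := Finset.card_le_card this
      rw [Nat.card_Icc, Nat.add_sub_cancel] at h1
      exact (Nat.cast_le.mpr h1).trans (Nat.floor_le hN0.le)
    refine (Finset.sum_le_card_nsmul _ _ 1 fun (p : S) _ => hb p p.2).trans ?_
    simpa using hcard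
  have hmain := norm_integral_exp_trigSum_sub_le (P := unitMeasure) (P' := cubeMeasure S)
    hXm continuous_steinhausPhases.measurable (fun p : S => b p) n
    (δ := 2 * N ^ (2 * n) / t) (β := N) (by positivity) hN hsum (by
      intro k hk
      rw [integral_exp_sum_steinhausPhases]
      split_ifs with h0
      · simp [h0]
        positivity
      · have hlow := inv_pow_le_abs_sum_log_primes hS hN hSN h0 hk
        have hpow : 0 < N ^ (2 * n) := by positivity
        set σ := ∑ p : S, (k p : ℝ) * Real.log p with hσ
        have hσ0 : 0 < |σ| := lt_of_lt_of_le (by positivity) hlow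
        have e4 : ∀ ω, ∑ p : S, (k p : ℝ) * X ω p = (-(t * σ)) * ω := by
          intro ω
          rw [hσ, Finset.mul_sum, ← Finset.sum_neg_distrib, Finset.sum_mul]
          refine Finset.sum_congr rfl fun p _ => ?_
          simp only [hX]
          ring
        simp_rw [e4]
        rw [sub_zero]
        refine (norm_integral_Ioo_exp_le (a := -(t * σ))
          (neg_ne_zero.mpr (mul_ne_zero ht.ne' (abs_pos.mp hσ0)))).trans ?_
        rw [abs_neg, abs_mul, abs_of_pos ht, div_le_div_iff₀ (by positivity) ht]
        have : 1 ≤ |σ| * N ^ (2 * n) := by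
          rwa [inv_le_iff_one_le_mul₀ hpow] at hlow
        nlinarith)
  have hmom := integral_trigSum_steinhausPhases_pow_le (fun p : S => b p) n
  have hgauss := norm_integral_exp_trigSum_steinhausPhases_sub_le (b := fun p : S => b p)
    fun p => hb p p.2
  calc _ ≤ _ + _ := norm_sub_le_norm_sub_add_norm_sub _
        (∫ θ, Complex.exp (trigSum (fun p : S => b p) (steinhausPhases θ) * Complex.I)
          ∂(cubeMeasure S)) _
    _ ≤ _ := by
      have : 4 * Real.exp (2 * ∑ p : S, ‖b p‖ ^ 2) / 4 ^ n =
        2 * (2 * Real.exp (2 * ∑ p : S, ‖b p‖ ^ 2) / 4 ^ n) := by ring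
      rw [this]
      linarith

end PrimeFrequencies

section PrimeLimit

/-- The central limit theorem for characteristic functions of short Dirichlet polynomials over
primes. -/
theorem tendsto_integral_exp_sum_primes {S : ℝ → Finset ℕ} {N η : ℝ → ℝ} {b : ℝ → ℕ → ℂ} {V : ℝ}
    (hN : ∀ᶠ t in atTop, 1 ≤ N t) (hNt : ∀ m : ℕ, Tendsto (fun t => N t ^ m / t) atTop (𝓝 0))
    (hS : ∀ᶠ t in atTop, ∀ p ∈ S t, p.Prime ∧ (p : ℝ) ≤ N t)
    (hη : Tendsto η atTop (𝓝 0)) (hb : ∀ᶠ t in atTop, ∀ p ∈ S t, ‖b t p‖ ≤ η t)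
    (hV : Tendsto (fun t => ∑ p ∈ S t, ‖b t p‖ ^ 2) atTop (𝓝 V)) :
    Tendsto (fun t => ∫ ω, Complex.exp ((∑ p ∈ S t, b t p *
        Complex.exp ((-(t * Real.log p) * ω : ℝ) * Complex.I)).re * Complex.I) ∂unitMeasure)
      atTop (𝓝 (Complex.exp (-(V / 4 : ℝ)))) := by
  have hgauss : Tendsto (fun t => Complex.exp (-((∑ p ∈ S t, ‖b t p‖ ^ 2) / 4 : ℝ))) atTop
      (𝓝 (Complex.exp (-(V / 4 : ℝ)))) :=
    (Complex.continuous_exp.tendsto _).comp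
      (((Complex.continuous_ofReal.tendsto _).comp (hV.div_const 4)).neg)
  suffices h : Tendsto (fun t => ∫ ω, Complex.exp ((∑ p ∈ S t, b t p *
        Complex.exp ((-(t * Real.log p) * ω : ℝ) * Complex.I)).re * Complex.I) ∂unitMeasure -
      Complex.exp (-((∑ p ∈ S t, ‖b t p‖ ^ 2) / 4 : ℝ))) atTop (𝓝 0) by
    simpa using h.add hgauss
  rw [Metric.tendsto_nhds]
  intro δ hδ
  obtain ⟨n, hn⟩ : ∃ n : ℕ, 4 * Real.exp (2 * V) / 4 ^ n < δ := by
    have h := (tendsto_pow_atTop_nhds_zero_of_lt_one (r := (1 / 4 : ℝ)) (by norm_num)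
      (by norm_num)).const_mul (4 * Real.exp (2 * V))
    rw [mul_zero] at h
    obtain ⟨n, hn⟩ := (h.eventually (gt_mem_nhds hδ)).exists
    refine ⟨n, ?_⟩
    rwa [one_div, inv_pow, ← div_eq_mul_inv] at hn
  have herr : Tendsto (fun t => (2 * n + 1) * 2 * (N t ^ (4 * n) / t) +
      4 * Real.exp (2 * ∑ p ∈ S t, ‖b t p‖ ^ 2) / 4 ^ n + 2 * (η t * ∑ p ∈ S t, ‖b t p‖ ^ 2))
      atTop (𝓝 ((2 * n + 1) * 2 * 0 + 4 * Real.exp (2 * V) / 4 ^ n + 2 * (0 * V))) :=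
    (((hNt (4 * n)).const_mul _).add
      ((((Real.continuous_exp.tendsto _).comp (hV.const_mul 2)).const_mul 4).div_const _)).add
      ((hη.mul hV).const_mul 2)
  rw [mul_zero, zero_mul, mul_zero, zero_add, add_zero] at herr
  filter_upwards [hN, hS, hb, herr.eventually (gt_mem_nhds hn), eventually_gt_atTop 0,
    hη.eventually (gt_mem_nhds one_pos)] with t h1 h2 h3 h4 h5 h6
  rw [dist_zero_right]
  refine lt_of_le_of_lt (norm_integral_exp_sum_primes_sub_le (fun p hp => (h2 p hp).1) h1
    (fun p hp => (h2 p hp).2) h5 (fun p hp => (h3 p hp).trans h6.le) n) (lt_of_le_of_lt ?_ h4)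
  have e1 : (2 * n + 1) * (2 * N t ^ (2 * n) / t) * N t ^ (2 * n) =
      (2 * n + 1) * 2 * (N t ^ (4 * n) / t) := by
    rw [show 4 * n = 2 * n + 2 * n by ring, pow_add]
    ring
  have e2 : ∑ p ∈ S t, ‖b t p‖ ^ 3 ≤ η t * ∑ p ∈ S t, ‖b t p‖ ^ 2 := by
    rw [Finset.mul_sum]
    refine Finset.sum_le_sum fun p hp => ?_
    rw [pow_succ']
    exact mul_le_mul_of_nonneg_right (h3 p hp) (by positivity)
  rw [e1]
  linarith

end PrimeLimit

section WeakConvergence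

lemma charFun_stdComplexNormal (ξ : ℂ) :
    charFun stdComplexNormal ξ = Complex.exp (-(‖ξ‖ ^ 2 / 4 : ℝ)) := by
  have hm : Measurable fun p : ℝ × ℝ => (p.1 : ℂ) + p.2 * Complex.I := by fun_prop
  have hg : ∀ s : ℝ, ∫ x : ℝ, Complex.exp (s * x * Complex.I)
      ∂(ProbabilityTheory.gaussianReal 0 (1/2)) = Complex.exp (-(s ^ 2 / 4 : ℝ)) := by
    intro s
    rw [← charFun_apply_real, ProbabilityTheory.charFun_gaussianReal]
    congr 1
    push_cast
    ring
  have hsplit : ∀ p : ℝ × ℝ, Complex.exp (inner ℝ ((p.1 : ℂ) + p.2 * Complex.I) ξ * Complex.I) =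
      Complex.exp (ξ.re * p.1 * Complex.I) * Complex.exp (ξ.im * p.2 * Complex.I) := by
    intro p
    rw [← Complex.exp_add, Complex.inner]
    congr 1
    simp
    ring
  rw [charFun_apply, stdComplexNormal, integral_map hm.aemeasurable
    (by fun_prop)]
  simp_rw [hsplit]
  rw [integral_prod_mul (fun x : ℝ => Complex.exp (ξ.re * x * Complex.I))
    (fun x : ℝ => Complex.exp (ξ.im * x * Complex.I)), hg, hg, ← Complex.exp_add,
    ← Complex.normSq_eq_norm_sq, Complex.normSq_apply]
  congr 1
  push_cast
  ring

lemma charFun_complexNormal {v : ℝ} (hv : 0 ≤ v) (ξ : ℂ) :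
    charFun (complexNormal v) ξ = Complex.exp (-(‖ξ‖ ^ 2 * v / 4 : ℝ)) := by
  have e : complexNormal v = stdComplexNormal.map fun z => Real.sqrt v • z := rfl
  rw [e, charFun_map_smul, charFun_stdComplexNormal, norm_smul, mul_pow, Real.norm_eq_abs, sq_abs,
    Real.sq_sqrt hv, mul_comm v]

instance : IsProbabilityMeasure stdComplexNormal :=
  Measure.isProbabilityMeasure_map (by fun_prop)

instance (v : ℝ) : IsProbabilityMeasure (complexNormal v) :=
  Measure.isProbabilityMeasure_map (by fun_prop)

/-- Lévy's continuity theorem for families indexed by a real parameter. -/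
theorem tendsto_integral_of_tendsto_charFun {Ω E : Type*} [MeasurableSpace Ω]
    {P : Measure Ω} [IsProbabilityMeasure P] [NormedAddCommGroup E] [InnerProductSpace ℝ E]
    [FiniteDimensional ℝ E] [MeasurableSpace E] [BorelSpace E] {X : ℝ → Ω → E}
    (hX : ∀ t, Measurable (X t)) {ν : Measure E} [IsProbabilityMeasure ν]
    (h : ∀ ξ, Tendsto (fun t => ∫ ω, Complex.exp (inner ℝ (X t ω) ξ * Complex.I) ∂P) atTop
      (𝓝 (charFun ν ξ))) (g : BoundedContinuousFunction E ℝ) :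
    Tendsto (fun t => ∫ ω, g (X t ω) ∂P) atTop (𝓝 (∫ x, g x ∂ν)) := by
  refine tendsto_of_seq_tendsto fun u hu => ?_
  have hprob : ∀ n, IsProbabilityMeasure (P.map (X (u n))) := fun n =>
    Measure.isProbabilityMeasure_map (hX _).aemeasurable
  let Q : ℕ → ProbabilityMeasure E := fun n => ⟨P.map (X (u n)), hprob n⟩
  let Q' : ProbabilityMeasure E := ⟨ν, inferInstance⟩
  have h1 : Tendsto Q atTop (𝓝 Q') := by
    refine ProbabilityMeasure.tendsto_of_tendsto_charFun fun ξ => ?_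
    refine ((h ξ).comp hu).congr fun n => ?_
    change _ = charFun (P.map (X (u n))) ξ
    rw [charFun_apply, integral_map (hX _).aemeasurable (by fun_prop)]
    rfl
  refine ((ProbabilityMeasure.tendsto_iff_forall_integral_tendsto.mp h1) g).congr fun n => ?_
  exact integral_map (hX _).aemeasurable g.continuous.aestronglyMeasurable

lemma norm_integral_exp_inner_sub_le {Ω E : Type*} [MeasurableSpace Ω] {P : Measure Ω}
    [IsProbabilityMeasure P] [NormedAddCommGroup E] [InnerProductSpace ℝ E] [MeasurableSpace E]
    [BorelSpace E] [SecondCountableTopology E] {X Y : Ω → E} (hX : Measurable X)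
    (hY : Measurable Y)
    (h : MemLp (fun ω => X ω - Y ω) 2 P) (ξ : E) :
    ‖∫ ω, Complex.exp (inner ℝ (X ω) ξ * Complex.I) ∂P -
      ∫ ω, Complex.exp (inner ℝ (Y ω) ξ * Complex.I) ∂P‖ ≤
      √(∫ ω, ‖X ω - Y ω‖ ^ 2 ∂P) * ‖ξ‖ := by
  have hX' : Measurable fun ω => inner ℝ (X ω) ξ := by fun_prop
  have hY' : Measurable fun ω => inner ℝ (Y ω) ξ := by fun_prop
  have h1 : Integrable (fun ω => ‖X ω - Y ω‖) P := (h.integrable one_le_two).norm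
  have hL2 : ∫ ω, ‖X ω - Y ω‖ ∂P ≤ √(∫ ω, ‖X ω - Y ω‖ ^ 2 ∂P) := by
    refine Real.le_sqrt_of_sq_le ?_
    have := ProbabilityTheory.variance_nonneg (fun ω => ‖X ω - Y ω‖) P
    rw [ProbabilityTheory.variance_eq_sub h.norm] at this
    simpa using this
  rw [← integral_sub (integrable_exp_mul_I hX') (integrable_exp_mul_I hY')]
  refine le_trans ?_ (mul_le_mul_of_nonneg_right hL2 (norm_nonneg ξ))
  rw [← integral_mul_const]
  refine norm_integral_le_of_norm_le (h1.mul_const _) (Eventually.of_forall fun ω => ?_)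
  have e : Complex.exp (inner ℝ (X ω) ξ * Complex.I) - Complex.exp (inner ℝ (Y ω) ξ * Complex.I) =
      Complex.exp (inner ℝ (Y ω) ξ * Complex.I) *
        (Complex.exp (Complex.I * (inner ℝ (X ω - Y ω) ξ : ℝ)) - 1) := by
    rw [mul_sub, ← Complex.exp_add, inner_sub_left]
    push_cast
    ring_nf
  rw [e, norm_mul, Complex.norm_exp_ofReal_mul_I, one_mul]
  refine (Real.norm_exp_I_mul_ofReal_sub_one_le).trans ?_
  exact norm_inner_le_norm _ _

end WeakConvergence

section Truncation

/-- The primes up to `x`. -/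
noncomputable def primesLE (x : ℝ) : Finset ℕ := (Finset.range (⌊x⌋₊ + 1)).filter Nat.Prime

lemma mem_primesLE {x : ℝ} {p : ℕ} : p ∈ primesLE x ↔ p.Prime ∧ (p : ℝ) ≤ x := by
  rw [primesLE, Finset.mem_filter, Finset.mem_range, Nat.lt_succ_iff, and_comm]
  exact and_congr_right fun hp => Nat.le_floor_iff' hp.ne_zero

/-- The length at which Dirichlet polynomials of length `t` are truncated. -/
noncomputable def truncation (ε : ℝ → ℝ) (t : ℝ) : ℝ := t ^ (-Real.log (ε t))⁻¹

lemma tendsto_log_add_div_div_atTop (A B a : ℝ) {d : ℝ} (hd : 0 < d) :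
    Tendsto (fun u : ℝ => (B + A * Real.log (a + u / d)) / u) atTop (𝓝 0) := by
  have h1 : Tendsto (fun u : ℝ => a + u / d) atTop atTop :=
    tendsto_atTop_add_const_left _ _ (tendsto_id.atTop_div_const hd)
  have h2 := Real.isLittleO_log_id_atTop.tendsto_div_nhds_zero.comp h1
  have h3 : Tendsto (fun u : ℝ => (a + u / d) / u) atTop (𝓝 (0 + 1 / d)) := by
    refine ((tendsto_const_nhds (x := a)).div_atTop tendsto_id |>.add_const (1 / d)).congr' ?_
    filter_upwards [eventually_ne_atTop 0] with u hu
    simp only [id]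
    field_simp
  have h4 := ((tendsto_const_nhds (x := B)).div_atTop tendsto_id).add ((h2.mul h3).const_mul A)
  rw [zero_mul, mul_zero, add_zero] at h4
  refine h4.congr' ?_
  filter_upwards [eventually_ne_atTop 0, h1.eventually (eventually_gt_atTop 0)] with u hu hu'
  simp only [id, Function.comp]
  generalize a + u / d = w at hu' ⊢
  have := hu'.ne'
  field_simp

variable {ε : ℝ → ℝ} {d : ℝ}

lemma tendsto_neg_log_atTop (hε : ∀ t, 0 < ε t) (hε0 : Tendsto ε atTop (𝓝 0)) :
    Tendsto (fun t => -Real.log (ε t)) atTop atTop :=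
  tendsto_neg_atBot_atTop.comp (Real.tendsto_log_nhdsGT_zero.comp
    (tendsto_nhdsWithin_iff.mpr ⟨hε0, Eventually.of_forall hε⟩))

lemma tendsto_neg_log_div_log (hε : ∀ t, 0 < ε t) (hε0 : Tendsto ε atTop (𝓝 0)) (hd : 0 < d)
    (hεd : ∀ᶠ t in atTop, d / Real.log t ≤ ε t) :
    Tendsto (fun t => -Real.log (ε t) / Real.log t) atTop (𝓝 0) := by
  have h1 := (tendsto_log_add_div_div_atTop 1 0 0 hd).comp Real.tendsto_log_atTop
  refine squeeze_zero' ?_ ?_ h1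
  · filter_upwards [(tendsto_neg_log_atTop hε hε0).eventually (eventually_ge_atTop 0),
      Real.tendsto_log_atTop.eventually (eventually_gt_atTop 0)] with t h2 h3
    positivity
  · filter_upwards [hεd, Real.tendsto_log_atTop.eventually (eventually_gt_atTop 0)] with t h2 h3
    simp only [Function.comp, zero_add, one_mul]
    gcongr
    rw [← Real.log_inv, ← inv_div]
    exact Real.log_le_log (inv_pos.mpr (hε t)) (inv_anti₀ (by positivity) h2)

lemma eventually_truncation_parameters (hε : ∀ t, 0 < ε t) (hε0 : Tendsto ε atTop (𝓝 0))
    (hd : 0 < d) (hεd : ∀ᶠ t in atTop, d / Real.log t ≤ ε t) :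
    ∀ᶠ t in atTop, 1 < t ∧ 1 ≤ -Real.log (ε t) ∧ 0 < -Real.log (ε t) / Real.log t ∧
      max (2 * ε t) (-Real.log (ε t) / Real.log t) ≤ 1 / 2 ∧
      2 * Real.log (2 * max (2 * ε t) (-Real.log (ε t) / Real.log t) / (2 * ε t)) ≤
        2 * Real.log (2 + -Real.log (ε t) / d) := by
  filter_upwards [eventually_gt_atTop 1,
    (tendsto_neg_log_atTop hε hε0).eventually (eventually_ge_atTop 1),
    hε0.eventually (Iic_mem_nhds (by norm_num : (0 : ℝ) < 1 / 4)),
    (tendsto_neg_log_div_log hε hε0 hd hεd).eventually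
      (Iic_mem_nhds (by norm_num : (0 : ℝ) < 1 / 2)), hεd] with t h1 h2 h3 h4 h5
  have hlog := Real.log_pos h1
  have hε' := hε t
  set L := -Real.log (ε t)
  have hy : 0 < L / Real.log t := by positivity
  refine ⟨h1, h2, hy, max_le (by linarith [h3]) h4, ?_⟩
  have hmax : 0 < max (2 * ε t) (L / Real.log t) := lt_max_of_lt_right hy
  gcongr
  rw [div_le_iff₀ (by positivity)]
  have h6 : d ≤ ε t * Real.log t := by rwa [div_le_iff₀ hlog] at h5
  have h7 : L / Real.log t ≤ ε t * (L / d) := by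
    rw [div_le_iff₀ hlog, mul_div_assoc', div_mul_eq_mul_div, le_div_iff₀ hd]
    nlinarith
  have h8 : 0 ≤ ε t * (L / d) := by positivity
  rcases max_cases (2 * ε t) (L / Real.log t) with ⟨h, _⟩ | ⟨h, _⟩ <;> rw [h] <;> nlinarith

lemma log_truncation {t : ℝ} (ht : 0 < t) :
    Real.log (truncation ε t) = Real.log t / -Real.log (ε t) := by
  rw [truncation, Real.log_rpow ht, inv_mul_eq_div]

lemma le_log_of_notMem_primesLE_truncation {t : ℝ} (ht : 0 < t) {p : ℕ} (hp : p.Prime)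
    (h : p ∉ primesLE (truncation ε t)) :
    1 / (-Real.log (ε t) / Real.log t) ≤ Real.log p := by
  rw [mem_primesLE, not_and] at h
  rw [one_div_div, ← log_truncation ht]
  exact Real.log_le_log (Real.rpow_pos_of_pos ht _) (not_le.mp (h hp)).le

lemma tendsto_truncation_pow_div (hε : ∀ t, 0 < ε t) (hε0 : Tendsto ε atTop (𝓝 0)) (m : ℕ) :
    Tendsto (fun t => truncation ε t ^ m / t) atTop (𝓝 0) := by
  have h := tendsto_rpow_neg_atTop (by norm_num : (0 : ℝ) < 1 / 2)
  refine squeeze_zero' ?_ ?_ h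
  · filter_upwards [eventually_gt_atTop 0] with t ht
    have := Real.rpow_pos_of_pos ht (-Real.log (ε t))⁻¹
    unfold truncation
    positivity
  · filter_upwards [eventually_gt_atTop 1, (tendsto_neg_log_atTop hε hε0).eventually
      (eventually_ge_atTop (max 1 (2 * m : ℝ)))] with t ht hL
    have ht0 : 0 < t := by linarith
    have hL1 := (le_max_left _ _).trans hL
    have hL2 := (le_max_right _ _).trans hL
    rw [truncation, ← Real.rpow_natCast, ← Real.rpow_mul ht0.le]
    rw [← Real.rpow_sub_one ht0.ne']
    refine Real.rpow_le_rpow_of_exponent_le ht.le ?_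
    have : (-Real.log (ε t))⁻¹ * m ≤ 1 / 2 := by
      rw [inv_mul_le_iff₀ (by linarith)]
      linarith
    linarith

/-- The primes discarded by the truncation have negligible mass. -/
lemma tendsto_sum_primes_tail_div (hε : ∀ t, 0 < ε t) (hε0 : Tendsto ε atTop (𝓝 0))
    (hd : 0 < d) (hεd : ∀ᶠ t in atTop, d / Real.log t ≤ ε t) :
    Tendsto (fun t => (∑ p ∈ primesLE t \ primesLE (truncation ε t),
      (p : ℝ) ^ (-(1 + 2 * ε t))) / -Real.log (ε t)) atTop (𝓝 0) := by
  obtain ⟨B, hB⟩ := exists_sum_prime_rpow_tail_le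
  have h1 := (tendsto_log_add_div_div_atTop 2 B 2 hd).comp (tendsto_neg_log_atTop hε hε0)
  refine squeeze_zero' ?_ ?_ h1
  · filter_upwards [(tendsto_neg_log_atTop hε hε0).eventually (eventually_ge_atTop 0)] with t ht
    positivity
  · filter_upwards [eventually_truncation_parameters hε hε0 hd hεd] with t ⟨h2, h3, h4, h5, h6⟩
    simp only [Function.comp]
    gcongr
    refine (hB _ _ (by linarith [hε t]) h4 h5 _ fun p hp => ?_).trans (by linarith)
    rw [Finset.mem_sdiff] at hp
    have hp1 := (mem_primesLE.mp hp.1).1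
    exact ⟨hp1, le_log_of_notMem_primesLE_truncation (by linarith) hp1 hp.2⟩

/-- Asymptotics of truncated prime zeta sums close to the edge of convergence. -/
lemma tendsto_sum_primes_cpow_div (hε : ∀ t, 0 < ε t) (hε0 : Tendsto ε atTop (𝓝 0))
    (hd : 0 < d) (hεd : ∀ᶠ t in atTop, d / Real.log t ≤ ε t) {Δ : ℝ → ℝ} {C : ℝ}
    (hΔ : ∀ t, |Δ t| ≤ C) {m : ℝ}
    (hm : Tendsto (fun t => Real.log ‖((2 * ε t : ℝ) : ℂ) + Δ t * Complex.I‖ / Real.log (ε t))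
      atTop (𝓝 m)) :
    Tendsto (fun t => (∑ p ∈ primesLE (truncation ε t),
      (p : ℂ) ^ (-(1 + (((2 * ε t : ℝ) : ℂ) + Δ t * Complex.I)))) / (-Real.log (ε t) : ℝ))
      atTop (𝓝 (m : ℂ)) := by
  obtain ⟨B, hB⟩ := exists_norm_LSeries_primeIndicator_sub_sum_le
  obtain ⟨B', hB'⟩ := exists_norm_LSeries_primeIndicator_add_log_le C
  have h1 := (tendsto_log_add_div_div_atTop 2 (B + B' + Real.pi) 2 hd).comp
    (tendsto_neg_log_atTop hε hε0)
  have hm' := (Complex.continuous_ofReal.tendsto _).comp hm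
  suffices h : Tendsto (fun t => (∑ p ∈ primesLE (truncation ε t),
      (p : ℂ) ^ (-(1 + (((2 * ε t : ℝ) : ℂ) + Δ t * Complex.I)))) / (-Real.log (ε t) : ℝ) -
      ((Real.log ‖((2 * ε t : ℝ) : ℂ) + Δ t * Complex.I‖ / Real.log (ε t) : ℝ) : ℂ))
      atTop (𝓝 0) by
    simpa using h.add hm'
  refine squeeze_zero_norm' ?_ h1
  filter_upwards [eventually_truncation_parameters hε hε0 hd hεd] with t ⟨h2, h3, h4, h5, h6⟩
  have hx : 0 < 2 * ε t := by linarith [hε t]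
  have h7 := hB (2 * ε t) _ (Δ t) hx h4 h5 (primesLE (truncation ε t))
    (fun p hp => (mem_primesLE.mp hp).1)
    fun p hp hp' => le_log_of_notMem_primesLE_truncation (by linarith) hp hp'
  set s : ℂ := ((2 * ε t : ℝ) : ℂ) + Δ t * Complex.I with hs
  have hsre : s.re = 2 * ε t := by simp [hs]
  have hsim : s.im = Δ t := by simp [hs]
  have h8 := hB' s (by linarith) (by linarith [(le_max_left _ _).trans h5]) (by rw [hsim]; exact hΔ t)
  set Z := ∑ p ∈ primesLE (truncation ε t), (p : ℂ) ^ (-(1 + s))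
  set L := -Real.log (ε t) with hL
  have hL0 : (0 : ℝ) < L := by linarith
  have hLC : (L : ℂ) ≠ 0 := by exact_mod_cast hL0.ne'
  have e1 : Real.log ‖s‖ / Real.log (ε t) = -Real.log ‖s‖ / L := by
    rw [hL, neg_div_neg_eq]
  have e2 : Complex.log s = Real.log ‖s‖ + s.arg * Complex.I := rfl
  have e3 : Z / L - ((Real.log ‖s‖ / Real.log (ε t) : ℝ) : ℂ) =
      (-(LSeries primeIndicator (1 + s) - Z) + (LSeries primeIndicator (1 + s) + Complex.log s) -
        s.arg * Complex.I) / L := by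
    rw [e1, e2]
    push_cast
    field_simp
    ring
  rw [e3, norm_div, Complex.norm_real, Real.norm_of_nonneg hL0.le]
  simp only [Function.comp]
  gcongr
  have h9 : ‖(s.arg : ℂ) * Complex.I‖ ≤ Real.pi := by
    simpa using Complex.abs_arg_le_pi s
  calc _ ≤ ‖LSeries primeIndicator (1 + s) - Z‖ +
        ‖LSeries primeIndicator (1 + s) + Complex.log s‖ + ‖(s.arg : ℂ) * Complex.I‖ := by
        refine (norm_sub_le _ _).trans (add_le_add_left ((norm_add_le _ _).trans ?_) _)
        rw [norm_neg]
    _ ≤ _ := by linarith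

end Truncation

section Covariance

variable {ε : ℝ → ℝ} {d : ℝ}

lemma tendsto_min_one_toReal {α : Type*} {l : Filter α} {r : α → ℝ} {c : ℝ≥0∞}
    (h : Tendsto (fun t => (r t : EReal)) l (𝓝 (c : EReal))) :
    Tendsto (fun t => min (r t) 1) l (𝓝 (min c 1).toReal) := by
  rw [← EReal.tendsto_coe]
  have e : (((min c 1).toReal : ℝ) : EReal) = min (c : EReal) 1 := by
    rw [← EReal.coe_ennreal_one, ← EReal.coe_ennreal_strictMono.monotone.map_min,
      ← EReal.coe_ennreal_toReal (ne_top_of_le_ne_top ENNReal.one_ne_top (min_le_right c 1))]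
  rw [e]
  refine (h.min tendsto_const_nhds).congr fun t => ?_
  rw [← EReal.coe_one, ← EReal.coe_strictMono.monotone.map_min]

lemma tendsto_log_norm_div_log (hε : ∀ t, 0 < ε t) (hε0 : Tendsto ε atTop (𝓝 0)) {Δ : ℝ → ℝ}
    (hΔ : ∀ t, Δ t ≠ 0) {c : ℝ≥0∞}
    (hc : Tendsto (fun t => ((Real.log |Δ t| / Real.log (ε t) : ℝ) : EReal)) atTop
      (𝓝 (c : EReal))) :
    Tendsto (fun t => Real.log ‖((2 * ε t : ℝ) : ℂ) + Δ t * Complex.I‖ / Real.log (ε t)) atTop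
      (𝓝 (min c 1).toReal) := by
  have hL := tendsto_neg_log_atTop hε hε0
  have h1 := tendsto_min_one_toReal hc
  suffices h : Tendsto (fun t => Real.log ‖((2 * ε t : ℝ) : ℂ) + Δ t * Complex.I‖ /
      Real.log (ε t) - min (Real.log |Δ t| / Real.log (ε t)) 1) atTop (𝓝 0) by
    simpa using h.add h1
  refine squeeze_zero_norm' ?_ ((tendsto_const_nhds (x := Real.log 3)).div_atTop hL)
  filter_upwards [hL.eventually (eventually_gt_atTop 0)] with t ht
  have hε' := hε t
  have hΔ' := abs_pos.mpr (hΔ t)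
  set s : ℂ := ((2 * ε t : ℝ) : ℂ) + Δ t * Complex.I with hs
  have hA : 0 < max (ε t) |Δ t| := lt_max_of_lt_left hε'
  have h2 : max (ε t) |Δ t| ≤ ‖s‖ := by
    refine max_le ?_ ?_
    · have h := (le_abs_self _).trans (Complex.abs_re_le_norm s)
      have hre : s.re = 2 * ε t := by simp [hs]
      linarith
    · simpa [hs] using Complex.abs_im_le_norm s
  have h3 : ‖s‖ ≤ 3 * max (ε t) |Δ t| := by
    have := norm_add_le ((2 * ε t : ℝ) : ℂ) (Δ t * Complex.I)
    rw [Complex.norm_real, norm_mul (Δ t : ℂ), Complex.norm_real, Complex.norm_I, mul_one,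
      Real.norm_of_nonneg (by positivity), Real.norm_eq_abs] at this
    linarith [le_max_left (ε t) |Δ t|, le_max_right (ε t) |Δ t|]
  have h4 := Real.log_le_log hA h2
  have h5 := Real.log_le_log (hA.trans_le h2) h3
  rw [Real.log_mul (by norm_num) hA.ne'] at h5
  have e1 : min (Real.log |Δ t| / Real.log (ε t)) 1 =
      Real.log (max (ε t) |Δ t|) / Real.log (ε t) := by
    have hneg : Real.log (ε t) < 0 := by linarith
    rcases le_total (ε t) |Δ t| with h | h
    · rw [max_eq_right h, min_eq_left]
      rw [div_le_one_of_neg hneg]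
      exact Real.log_le_log hε' h
    · rw [max_eq_left h, div_self hneg.ne, min_eq_right]
      rw [one_le_div_of_neg hneg]
      exact Real.log_le_log hΔ' h
  rw [e1, ← sub_div, norm_div, Real.norm_eq_abs, Real.norm_eq_abs, abs_of_nonneg (by linarith),
    ← abs_neg (Real.log (ε t)), abs_of_pos ht]
  gcongr
  linarith

lemma tendsto_log_norm_two_mul_div_log (hε : ∀ t, 0 < ε t) (hε0 : Tendsto ε atTop (𝓝 0)) :
    Tendsto (fun t => Real.log ‖((2 * ε t : ℝ) : ℂ) + (0 : ℝ) * Complex.I‖ / Real.log (ε t)) atTop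
      (𝓝 1) := by
  have hL := tendsto_neg_log_atTop hε hε0
  have h := ((tendsto_const_nhds (x := -Real.log 2)).div_atTop hL).add_const 1
  rw [zero_add] at h
  refine h.congr' ?_
  filter_upwards [hL.eventually (eventually_gt_atTop 0)] with t ht
  have hneg : Real.log (ε t) ≠ 0 := by linarith
  rw [Complex.ofReal_zero, zero_mul, add_zero, Complex.norm_real,
    Real.norm_of_nonneg (by linarith [hε t]), Real.log_mul two_ne_zero (hε t).ne', neg_div_neg_eq,
    add_div, div_self hneg]

variable {ι : Type*} [Fintype ι]

/-- The coefficient of `p ^ (-iωt)` in a linear combination of shifted Dirichlet polynomials. -/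
noncomputable def shiftedCoeff (μ : ι → ℂ) (ε : ℝ → ℝ) (f : ι → ℝ → ℝ) (t : ℝ) (p : ℕ) : ℂ :=
  ∑ j, μ j / (p : ℂ) ^ ((1/2 : ℂ) + ε t + Complex.I * f j t)

variable {μ : ι → ℂ} {f : ι → ℝ → ℝ}

lemma norm_shiftedCoeff_le (t : ℝ) {p : ℕ} (hp : 0 < p) :
    ‖shiftedCoeff μ ε f t p‖ ≤ (∑ j, ‖μ j‖) * (p : ℝ) ^ (-(1 / 2 + ε t)) := by
  rw [shiftedCoeff, Finset.sum_mul]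
  refine norm_sum_le_of_le _ fun j _ => le_of_eq ?_
  rw [norm_div, Complex.norm_natCast_cpow_of_pos hp, Real.rpow_neg (Nat.cast_nonneg p),
    div_eq_mul_inv]
  simp

lemma norm_shiftedCoeff_sq_le (t : ℝ) {p : ℕ} (hp : 0 < p) :
    ‖shiftedCoeff μ ε f t p‖ ^ 2 ≤ (∑ j, ‖μ j‖) ^ 2 * (p : ℝ) ^ (-(1 + 2 * ε t)) := by
  refine (pow_le_pow_left₀ (norm_nonneg _) (norm_shiftedCoeff_le t hp) 2).trans (le_of_eq ?_)
  rw [mul_pow, ← Real.rpow_natCast ((p : ℝ) ^ _), ← Real.rpow_mul (Nat.cast_nonneg p)]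
  congr 2
  push_cast
  ring

lemma norm_shiftedCoeff_le_mul_inv_sqrt {t : ℝ} (hε : 0 < ε t) {p : ℕ} (hp : 0 < p) :
    ‖shiftedCoeff μ ε f t p‖ ≤ (∑ j, ‖μ j‖) * (√p)⁻¹ := by
  refine (norm_shiftedCoeff_le t hp).trans ?_
  have : 0 ≤ ∑ j, ‖μ j‖ := Finset.sum_nonneg fun _ _ => norm_nonneg _
  rw [Real.sqrt_eq_rpow, ← Real.rpow_neg (Nat.cast_nonneg p)]
  gcongr
  · exact_mod_cast hp
  · linarith

lemma norm_shiftedCoeff_le_sum {t : ℝ} (hε : 0 < ε t) {p : ℕ} (hp : 0 < p) :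
    ‖shiftedCoeff μ ε f t p‖ ≤ ∑ j, ‖μ j‖ := by
  refine (norm_shiftedCoeff_le_mul_inv_sqrt hε hp).trans
    (mul_le_of_le_one_right (Finset.sum_nonneg fun _ _ => norm_nonneg _) ?_)
  refine inv_le_one_of_one_le₀ (Real.one_le_sqrt.mpr ?_)
  exact_mod_cast hp

lemma ofReal_norm_shiftedCoeff_sq (t : ℝ) {p : ℕ} (hp : 0 < p) :
    ((‖shiftedCoeff μ ε f t p‖ ^ 2 : ℝ) : ℂ) = ∑ j, ∑ k, conj (μ j) * μ k *
      (p : ℂ) ^ (-(1 + (((2 * ε t : ℝ) : ℂ) + (f k t - f j t : ℝ) * Complex.I))) := by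
  have hp0 : (p : ℂ) ≠ 0 := by exact_mod_cast hp.ne'
  have harg : (p : ℂ).arg ≠ Real.pi := by
    rw [Complex.natCast_arg]
    exact Real.pi_pos.ne
  rw [Complex.ofReal_pow, ← Complex.conj_mul', shiftedCoeff, map_sum, Finset.sum_mul_sum]
  refine Finset.sum_congr rfl fun j _ => Finset.sum_congr rfl fun k _ => ?_
  have h := Complex.cpow_conj (p : ℂ) ((1/2 : ℂ) + ε t + Complex.I * f j t) harg
  rw [Complex.conj_natCast] at h
  rw [map_div₀, ← h, div_mul_div_comm, ← Complex.cpow_add _ _ hp0, div_eq_mul_inv,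
    ← Complex.cpow_neg]
  congr 2
  simp [map_ofNat (starRingEnd ℂ) 2]
  ring

lemma tendsto_sum_norm_shiftedCoeff_sq_div [DecidableEq ι] (hε : ∀ t, 0 < ε t)
    (hε0 : Tendsto ε atTop (𝓝 0)) (hd : 0 < d) (hεd : ∀ᶠ t in atTop, d / Real.log t ≤ ε t) {C : ℝ}
    (hf : ∀ t i j, |f j t - f i t| ≤ C) (hne : ∀ t i j, i ≠ j → f j t - f i t ≠ 0)
    {c : ι → ι → ℝ≥0∞}
    (hc : ∀ i j, i ≠ j →
      Tendsto (fun t => ((Real.log |f j t - f i t| / Real.log (ε t) : ℝ) : EReal))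
        atTop (𝓝 (c i j))) :
    Tendsto (fun t => (∑ p ∈ primesLE (truncation ε t), ‖shiftedCoeff μ ε f t p‖ ^ 2) /
      -Real.log (ε t)) atTop (𝓝 (∑ j, ∑ k, if j = k then ((‖μ j‖ : ℂ) ^ 2)
        else conj (μ j) * μ k * ((min (c j k) 1).toReal : ℂ)).re) := by
  have h1 : ∀ j k, Tendsto (fun t => conj (μ j) * μ k * ((∑ p ∈ primesLE (truncation ε t),
      (p : ℂ) ^ (-(1 + (((2 * ε t : ℝ) : ℂ) + (f k t - f j t : ℝ) * Complex.I)))) /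
        (-Real.log (ε t) : ℝ))) atTop (𝓝 (if j = k then ((‖μ j‖ : ℂ) ^ 2)
        else conj (μ j) * μ k * ((min (c j k) 1).toReal : ℂ))) := by
    intro j k
    split_ifs with hjk
    · subst hjk
      have h := tendsto_sum_primes_cpow_div hε hε0 hd hεd (Δ := fun _ => 0) (C := C)
        (fun t => by simpa using hf t j j) (tendsto_log_norm_two_mul_div_log hε hε0)
      have h' := h.const_mul (conj (μ j) * μ j)
      rw [Complex.ofReal_one, mul_one, Complex.conj_mul'] at h'
      simp_rw [sub_self]
      rwa [Complex.conj_mul']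
    · exact (tendsto_sum_primes_cpow_div hε hε0 hd hεd (fun t => hf t j k)
        (tendsto_log_norm_div_log hε hε0 (fun t => hne t j k hjk) (hc j k hjk))).const_mul _
  have h2 := (Complex.continuous_re.tendsto _).comp
    (tendsto_finsetSum Finset.univ fun j _ => tendsto_finsetSum Finset.univ fun k _ => h1 j k)
  refine h2.congr fun t => ?_
  rw [← Complex.ofReal_re ((∑ p ∈ primesLE (truncation ε t), ‖shiftedCoeff μ ε f t p‖ ^ 2) /
      -Real.log (ε t))]
  simp only [Function.comp]
  congr 1
  symm
  have h3 : ∀ p ∈ primesLE (truncation ε t), ((‖shiftedCoeff μ ε f t p‖ ^ 2 : ℝ) : ℂ) = _ :=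
    fun p hp => ofReal_norm_shiftedCoeff_sq t (mem_primesLE.mp hp).1.pos
  rw [Complex.ofReal_div, Complex.ofReal_sum, Finset.sum_congr rfl h3, Finset.sum_comm,
    Finset.sum_div]
  refine Finset.sum_congr rfl fun j _ => ?_
  rw [Finset.sum_comm, Finset.sum_div]
  refine Finset.sum_congr rfl fun k _ => ?_
  rw [← Finset.mul_sum, mul_div_assoc]

end Covariance

section Assembly

/-- The Dirichlet polynomial over the primes in `S` with coefficients `a` at height `ω * t`. -/
noncomputable def primePolynomial (S : Finset ℕ) (a : ℕ → ℂ) (t ω : ℝ) : ℂ :=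
  ∑ p ∈ S, a p * Complex.exp ((-(t * Real.log p) * ω : ℝ) * Complex.I)

@[fun_prop]
lemma continuous_primePolynomial (S : Finset ℕ) (a : ℕ → ℂ) (t : ℝ) :
    Continuous (primePolynomial S a t) := by
  unfold primePolynomial
  fun_prop

lemma norm_primePolynomial_le (S : Finset ℕ) (a : ℕ → ℂ) (t ω : ℝ) :
    ‖primePolynomial S a t ω‖ ≤ ∑ p ∈ S, ‖a p‖ :=
  norm_sum_le_of_le _ fun p _ => by rw [norm_mul, Complex.norm_exp_ofReal_mul_I, mul_one]

lemma memLp_primePolynomial (S : Finset ℕ) (a : ℕ → ℂ) (t : ℝ) :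
    MemLp (primePolynomial S a t) 2 unitMeasure :=
  MemLp.of_bound (continuous_primePolynomial S a t).aestronglyMeasurable _
    (Eventually.of_forall fun ω => norm_primePolynomial_le S a t ω)

lemma mul_primePolynomial (z : ℂ) (S : Finset ℕ) (a : ℕ → ℂ) (t ω : ℝ) :
    z * primePolynomial S a t ω = primePolynomial S (fun p => z * a p) t ω := by
  simp_rw [primePolynomial, Finset.mul_sum, mul_assoc]

lemma primePolynomial_sub_of_subset {S T : Finset ℕ} (h : S ⊆ T) (a : ℕ → ℂ) (t ω : ℝ) :
    primePolynomial T a t ω - primePolynomial S a t ω = primePolynomial (T \ S) a t ω := by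
  rw [primePolynomial, ← Finset.sum_sdiff h]
  exact add_sub_cancel_right _ _

variable {ι : Type*} [Fintype ι] {μ : ι → ℂ} {ε : ℝ → ℝ} {d : ℝ} {f : ι → ℝ → ℝ}

lemma sum_mul_sum_cpow_eq_primePolynomial (t ω : ℝ) :
    ∑ j, μ j * ∑ p ∈ primesLE t, (p : ℂ) ^ (-(Complex.I * ω * t)) /
      (p : ℂ) ^ ((1/2 : ℂ) + ε t + Complex.I * f j t) =
      primePolynomial (primesLE t) (shiftedCoeff μ ε f t) t ω := by
  simp_rw [primePolynomial, shiftedCoeff, Finset.sum_mul, Finset.mul_sum]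
  rw [Finset.sum_comm]
  refine Finset.sum_congr rfl fun p hp => Finset.sum_congr rfl fun j _ => ?_
  have hp0 : (p : ℂ) ≠ 0 := by exact_mod_cast (mem_primesLE.mp hp).1.ne_zero
  have e : (p : ℂ) ^ (-(Complex.I * ω * t)) =
      Complex.exp ((-(t * Real.log p) * ω : ℝ) * Complex.I) := by
    rw [Complex.cpow_def_of_ne_zero hp0, ← Complex.natCast_log]
    congr 1
    push_cast
    ring
  rw [e]
  ring

lemma inv_sqrt_sq {x : ℝ} (hx : 0 ≤ x) : ‖((√x : ℝ) : ℂ)⁻¹‖ ^ 2 = x⁻¹ := by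
  rw [norm_inv, Complex.norm_real, Real.norm_of_nonneg (Real.sqrt_nonneg x), inv_pow,
    Real.sq_sqrt hx]

/-- Truncating the normalized Dirichlet polynomials does not change their limit in `L²`. -/
lemma tendsto_integral_norm_sq_sub_truncation (hε : ∀ t, 0 < ε t)
    (hε0 : Tendsto ε atTop (𝓝 0)) (hd : 0 < d) (hεd : ∀ᶠ t in atTop, d / Real.log t ≤ ε t) :
    Tendsto (fun t => ∫ ω,
      ‖((√(-Real.log (ε t)) : ℝ) : ℂ)⁻¹ *
          primePolynomial (primesLE t) (shiftedCoeff μ ε f t) t ω -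
        ((√(-Real.log (ε t)) : ℝ) : ℂ)⁻¹ *
          primePolynomial (primesLE (truncation ε t)) (shiftedCoeff μ ε f t) t ω‖ ^ 2
      ∂unitMeasure) atTop (𝓝 0) := by
  set M := ∑ j, ‖μ j‖
  have hL := tendsto_neg_log_atTop hε hε0
  have h1 := ((tendsto_sum_primes_tail_div hε hε0 hd hεd).const_mul (M ^ 2)).add
    ((tendsto_const_nhds (x := 48 * M ^ 2)).div_atTop hL)
  rw [mul_zero, add_zero] at h1
  refine squeeze_zero' (Eventually.of_forall fun t => integral_nonneg fun ω => by positivity) ?_ h1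
  filter_upwards [hL.eventually (eventually_ge_atTop 1), eventually_ge_atTop 1,
    eventually_integral_norm_sq_sum_primes_le] with t h2 h3 h4
  have hsub : primesLE (truncation ε t) ⊆ primesLE t := by
    intro p hp
    rw [mem_primesLE] at hp ⊢
    refine ⟨hp.1, hp.2.trans ?_⟩
    rw [truncation]
    conv_rhs => rw [← Real.rpow_one t]
    exact Real.rpow_le_rpow_of_exponent_le h3 (inv_le_one_of_one_le₀ h2)
  have hL0 : 0 < -Real.log (ε t) := by linarith
  simp_rw [← mul_sub, primePolynomial_sub_of_subset hsub, norm_mul, mul_pow, inv_sqrt_sq hL0.le]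
  rw [integral_const_mul, ← mul_div_assoc, ← add_div, div_eq_inv_mul]
  refine mul_le_mul_of_nonneg_left ?_ (inv_nonneg.mpr hL0.le)
  have hpos : ∀ p ∈ primesLE t \ primesLE (truncation ε t), p.Prime ∧ (p : ℝ) ≤ t :=
    fun p hp => mem_primesLE.mp (Finset.mem_sdiff.mp hp).1
  refine (h4 _ _ M hpos fun p hp =>
    norm_shiftedCoeff_le_mul_inv_sqrt (hε t) (hpos p hp).1.pos).trans ?_
  rw [Finset.mul_sum]
  gcongr with p hp
  exact norm_shiftedCoeff_sq_le t (hpos p hp).1.pos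

/-- The limiting characteristic functions of the truncated Dirichlet polynomials. -/
lemma tendsto_charFun_truncation (hε : ∀ t, 0 < ε t) (hε0 : Tendsto ε atTop (𝓝 0)) {v : ℝ}
    (hv : Tendsto (fun t => (∑ p ∈ primesLE (truncation ε t), ‖shiftedCoeff μ ε f t p‖ ^ 2) /
      -Real.log (ε t)) atTop (𝓝 v)) (ξ : ℂ) :
    Tendsto (fun t => ∫ ω, Complex.exp (inner ℝ (((√(-Real.log (ε t)) : ℝ) : ℂ)⁻¹ *
      primePolynomial (primesLE (truncation ε t)) (shiftedCoeff μ ε f t) t ω) ξ * Complex.I)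
      ∂unitMeasure) atTop (𝓝 (Complex.exp (-(‖ξ‖ ^ 2 * v / 4 : ℝ)))) := by
  have hL := tendsto_neg_log_atTop hε hε0
  have hη : Tendsto (fun t => ‖ξ‖ * ((∑ j, ‖μ j‖) / √(-Real.log (ε t)))) atTop (𝓝 0) := by
    simpa using ((tendsto_const_nhds (x := ∑ j, ‖μ j‖)).div_atTop
      (Real.tendsto_sqrt_atTop.comp hL)).const_mul ‖ξ‖
  have hV : Tendsto (fun t => ∑ p ∈ primesLE (truncation ε t),
      ‖conj ξ * (((√(-Real.log (ε t)) : ℝ) : ℂ)⁻¹ * shiftedCoeff μ ε f t p)‖ ^ 2) atTop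
      (𝓝 (‖ξ‖ ^ 2 * v)) := by
    refine (hv.const_mul (‖ξ‖ ^ 2)).congr' ?_
    filter_upwards [hL.eventually (eventually_ge_atTop 0)] with t ht
    simp_rw [norm_mul, mul_pow, inv_sqrt_sq ht, RCLike.norm_conj]
    rw [← Finset.mul_sum, ← Finset.mul_sum, div_eq_inv_mul]
  refine (tendsto_integral_exp_sum_primes (S := fun t => primesLE (truncation ε t))
    (N := truncation ε) ?_ (tendsto_truncation_pow_div hε hε0)
    (Eventually.of_forall fun t p hp => mem_primesLE.mp hp) hη
    (Eventually.of_forall fun t p hp => ?_) hV).congr fun t => ?_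
  · filter_upwards [eventually_ge_atTop 1, hL.eventually (eventually_ge_atTop 0)] with t ht ht'
    exact Real.one_le_rpow ht (inv_nonneg.mpr ht')
  · rw [norm_mul, norm_mul, RCLike.norm_conj, norm_inv, Complex.norm_real,
      Real.norm_of_nonneg (Real.sqrt_nonneg _), div_eq_inv_mul]
    gcongr
    exact norm_shiftedCoeff_le_sum (hε t) (mem_primesLE.mp hp).1.pos
  · refine integral_congr_ae (Eventually.of_forall fun ω => ?_)
    change Complex.exp ((primePolynomial (primesLE (truncation ε t)) (fun p => conj ξ *
      (((√(-Real.log (ε t)) : ℝ) : ℂ)⁻¹ * shiftedCoeff μ ε f t p)) t ω).re * Complex.I) = _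
    beta_reduce
    rw [← mul_primePolynomial, ← mul_primePolynomial, Complex.inner, ← Complex.conj_re (ξ * _),
      map_mul, Complex.conj_conj]

lemma tendsto_charFun_primePolynomial (hε : ∀ t, 0 < ε t)
    (hε0 : Tendsto ε atTop (𝓝 0)) (hd : 0 < d) (hεd : ∀ᶠ t in atTop, d / Real.log t ≤ ε t) {v : ℝ}
    (hv : Tendsto (fun t => (∑ p ∈ primesLE (truncation ε t), ‖shiftedCoeff μ ε f t p‖ ^ 2) /
      -Real.log (ε t)) atTop (𝓝 v)) (ξ : ℂ) :
    Tendsto (fun t => ∫ ω, Complex.exp (inner ℝ (((√(-Real.log (ε t)) : ℝ) : ℂ)⁻¹ *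
      primePolynomial (primesLE t) (shiftedCoeff μ ε f t) t ω) ξ * Complex.I)
      ∂unitMeasure) atTop (𝓝 (Complex.exp (-(‖ξ‖ ^ 2 * v / 4 : ℝ)))) := by
  have h1 := ((Real.continuous_sqrt.tendsto 0).comp
    (tendsto_integral_norm_sq_sub_truncation (μ := μ) (f := f) hε hε0 hd hεd)).mul_const ‖ξ‖
  rw [Real.sqrt_zero, zero_mul] at h1
  have h2 := squeeze_zero_norm (fun t => norm_integral_exp_inner_sub_le (P := unitMeasure)
    (X := fun ω => ((√(-Real.log (ε t)) : ℝ) : ℂ)⁻¹ *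
      primePolynomial (primesLE t) (shiftedCoeff μ ε f t) t ω)
    (Y := fun ω => ((√(-Real.log (ε t)) : ℝ) : ℂ)⁻¹ *
      primePolynomial (primesLE (truncation ε t)) (shiftedCoeff μ ε f t) t ω)
    (by fun_prop) (by fun_prop)
    (((memLp_primePolynomial _ _ t).const_mul _).sub
      ((memLp_primePolynomial _ _ t).const_mul _)) ξ) h1
  simpa using h2.add (tendsto_charFun_truncation hε hε0 hv ξ)

end Assembly

/-- The "Equivalent of Theorem 1" in the paper: a CLT for the Dirichlet polynomial
`(-log ε_t)^{-1/2} ∑_j μ_j ∑_{p ≤ t} p^{-iωt} / p^{1/2+ε_t+i f_t^{(j)}}`. -/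
theorem dirichlet_polynomial_clt
    (ℓ : ℕ) (hℓ : 1 ≤ ℓ)
    (ε : ℝ → ℝ) (hεpos : ∀ t, 0 < ε t) (hε0 : Tendsto ε atTop (𝓝 0))
    (d : ℝ) (hd : 0 < d) (hεlb : ∀ᶠ t in atTop, d / Real.log t ≤ ε t)
    (f : Fin ℓ → ℝ → ℝ) (C : ℝ)
    (hf0 : ∀ t i, 0 ≤ f i t)
    (hfmono : ∀ t, StrictMono fun i => f i t)
    (hfC : ∀ t i, f i t < C)
    (c : Fin ℓ → Fin ℓ → ℝ≥0∞)
    (hc : ∀ i j, i ≠ j →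
      Tendsto (fun t => ((Real.log |f j t - f i t| / Real.log (ε t) : ℝ) : EReal))
        atTop (𝓝 (c i j)))
    (μ : Fin ℓ → ℂ) :
    ∀ g : BoundedContinuousFunction ℂ ℝ,
      Tendsto (fun t => ∫ ω in Set.Ioo (0:ℝ) 1,
          g ((Real.sqrt (-Real.log (ε t)) : ℂ)⁻¹ *
            ∑ j, μ j * ∑ p ∈ Finset.filter Nat.Prime (Finset.range (⌊t⌋₊ + 1)),
              (p : ℂ) ^ (-(Complex.I * ω * t)) /
                (p : ℂ) ^ ((1/2 : ℂ) + ε t + Complex.I * f j t)))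
        atTop
        (𝓝 (∫ z, g z ∂(complexNormal
          (∑ j, ∑ k, if j = k then ((‖μ j‖ : ℂ) ^ 2)
            else conj (μ j) * μ k * ((min (c j k) 1).toReal : ℂ)).re))) := by
  intro g
  have hfC' : ∀ t i j, |f j t - f i t| ≤ C := fun t i j =>
    abs_le.mpr ⟨by linarith [hf0 t j, hfC t i], by linarith [hf0 t i, hfC t j]⟩
  have hne : ∀ t i j, i ≠ j → f j t - f i t ≠ 0 := fun t i j hij =>
    sub_ne_zero.mpr fun h => hij ((hfmono t).injective h).symm
  have hv := tendsto_sum_norm_shiftedCoeff_sq_div (μ := μ) hεpos hε0 hd hεlb hfC' hne hc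
  have hv0 := ge_of_tendsto hv (by
    filter_upwards [(tendsto_neg_log_atTop hεpos hε0).eventually (eventually_ge_atTop 0)] with t ht
    positivity)
  refine (tendsto_integral_of_tendsto_charFun (P := unitMeasure)
    (X := fun t ω => ((√(-Real.log (ε t)) : ℝ) : ℂ)⁻¹ *
      primePolynomial (primesLE t) (shiftedCoeff μ ε f t) t ω)
    (fun t => by fun_prop) (fun ξ => ?_) g).congr fun t => ?_
  · rw [charFun_complexNormal hv0]
    exact tendsto_charFun_primePolynomial hεpos hε0 hd hεlb hv ξ
  · simp_rw [← sum_mul_sum_cpow_eq_primePolynomial]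
    rfl
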